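/- arXiv:1603.01828 — 2 statements merged into one kernel-verified Lean document; each statement's English description precedes it below -/
import Mathlib

section
/- Assume n_1 < n_3 and n_2 > n_4 (so n_1 < n_3 < n_4 < n_2 and n = n_2). Fix a Smith datum (U^{(1)}, V^{(1)}, d^{(1)}_1 | … | d^{(1)}_{s_1}) for E_{11}, a Smith datum (U^{(3)}, V^{(3)}, d^{(3)}_1 | … | d^{(3)}_{s_3}) for (E_{11}; E_{21}), a Smith datum (U^{(2)}, V^{(2)}, d^{(2)}_1 | … | d^{(2)}_{s_2}) for (E_{11}; E_{12}; E_{21}; E_{22}), and a Smith datum (U^{(4)}, V^{(4)}, d^{(4)}_1 | … | d^{(4)}_{s_4}) for (E_{11}; E_{21}; E_{22}). Define H_1 = #{(u_1,…,u_{r_1}) ∈ (F_q^*)^{r_1} : Σ_{i=1}^{r_1} a_{1,i} u_i = b_1 and u satisfies the index condition for (E_{11}, U^{(1)}, d^{(1)})}; H_3 = #{(u_1,…,u_{r_1}, v_1,…,v_{r_3}) ∈ (F_q^*)^{r_1+r_3} : Σ_{i=1}^{r_1} a_{1,i} u_i = b_1, Σ_{j=1}^{r_3} a_{2,j} v_j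 = b_2, and (u,v) satisfies the index condition for ((E_{11}; E_{21}), U^{(3)}, d^{(3)})}; H_2 = #{(u_1,…,u_{r_2}, v_1,…,v_{r_4}) ∈ (F_q^*)^{r_2+r_4} : Σ_{i=1}^{r_2} a_{1,i} u_i = b_1, Σ_{j=1}^{r_4} a_{2,j} v_j = b_2, and (u,v) satisfies the index condition for ((E_{11}; E_{12}; E_{21}; E_{22}), U^{(2)}, d^{(2)})}; H_4 = #{(u_1,…,u_{r_1}, v_1,…,v_{r_4}) ∈ (F_q^*)^{r_1+r_4} : Σ_{i=1}^{r_1} a_{1,i} u_i = b_1, Σ_{j=1}^{r_4} a_{2,j} v_j = b_2, and (u,v) satisfies the index condition for ((E_{11}; E_{21}; E_{22}), U^{(4)}, d^{(4)})}; and for l = 1,2,3,4 set L_l = H_l · (q−1)^{n_l − s_l} · ∏_{j=1}^{s_l} gcd(q−1, d^{(l)}_j). Then N = N_0 + N_1 + N_2 + N_4 + N_5, where N_0 = q^{n_2−n_1}(q^{n_1} − (q−1)^{n_1}) if b_1 = b_2 = 0 and N_0 = 0 otherwise; N_1 = q^{n_2−n_3}(q^{n_3−n_1} − (q−1)^{n_3−n_1})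 L_1 if b_2 = 0 and N_1 = 0 otherwise; N_2 = q^{n_2−n_4}(q^{n_4−n_3} − (q−1)^{n_4−n_3}) L_3; N_4 = L_2; and N_5 = (q^{n_2−n_4} − (q−1)^{n_2−n_4}) L_4. -/
open Finset

/-- Stack the first `p1` rows of `E1` on top of the first `p2` rows of `E2`,
viewed as an integer matrix with `n` columns. -/
def stackM (E1 E2 : ℕ → ℕ → ℕ) (p1 p2 n : ℕ) :
    Matrix (Fin (p1 + p2)) (Fin n) ℤ :=
  Matrix.of fun i j =>
    if (i : ℕ) < p1 then (E1 (i : ℕ) (j : ℕ) : ℤ) else (E2 ((i : ℕ) - p1) (j : ℕ) : ℤ)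

/-- `(U, V, d 0 ∣ d 1 ∣ ⋯ ∣ d (s-1))` is a Smith datum for the matrix `M`:
`U` and `V` are unimodular and `U * M * V` is diagonal with the positive
invariant factors `d 0 ∣ ⋯ ∣ d (s-1)` on the diagonal and zeros elsewhere. -/
def IsSmithDatum {ρ n : ℕ} (M : Matrix (Fin ρ) (Fin n) ℤ)
    (U : Matrix (Fin ρ) (Fin ρ) ℤ) (V : Matrix (Fin n) (Fin n) ℤ)
    (s : ℕ) (d : ℕ → ℕ) : Prop :=
  IsUnit U.det ∧ IsUnit V.det ∧ s ≤ ρ ∧ s ≤ n ∧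
    (∀ j, j < s → 0 < d j) ∧ (∀ j, j + 1 < s → d j ∣ d (j + 1)) ∧
    ∀ i k, (U * M * V) i k =
      if (i : ℕ) = (k : ℕ) ∧ (i : ℕ) < s then (d (i : ℕ) : ℤ) else 0

/-- The index condition: writing `h' = U ⬝ w` (where `w` is the vector of
indices of the `uᵢ`), one has `gcd (m, d j) ∣ h'_j` for `j < s` and
`m ∣ h'_j` for `s ≤ j`. Here `m` plays the role of `q - 1`. -/
def IndexCond {ρ : ℕ} (m : ℕ) (U : Matrix (Fin ρ) (Fin ρ) ℤ)
    (s : ℕ) (d : ℕ → ℕ) (w : Fin ρ → ℤ) : Prop :=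
  ∀ j : Fin ρ,
    (if (j : ℕ) < s then ((Nat.gcd m (d (j : ℕ))) : ℤ) else (m : ℤ)) ∣ (U.mulVec w) j

theorem ZMod.card_natCast_mul_eq_intCast (m : ℕ) [NeZero m] (d : ℕ) (h : ℤ)
    (hd : ((m.gcd d : ℕ) : ℤ) ∣ h) :
    Nat.card {a : ZMod m // (d : ZMod m) * a = (h : ZMod m)} = m.gcd d := by
  obtain ⟨k, rfl⟩ := hd
  have hsol : (d : ZMod m) * ((m.gcdB d * k : ℤ) : ZMod m) = ((m.gcd d * k : ℤ) : ZMod m) := by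
    rw [Nat.gcd_eq_gcd_ab m d]
    push_cast
    simp [mul_assoc]
  have hker := IsAddCyclic.card_nsmulAddMonoidHom_ker (ZMod m) d
  rw [Nat.card_zmod] at hker
  refine Eq.trans (Nat.card_congr
    ((Equiv.subRight ((m.gcdB d * k : ℤ) : ZMod m)).subtypeEquiv fun a => ?_)) hker
  rw [AddMonoidHom.mem_ker, ← hsol]
  simp [mul_sub, sub_eq_zero]

theorem ZMod.gcd_dvd_of_natCast_mul_eq (m : ℕ) (d : ℕ) (h : ℤ) (a : ZMod m)
    (ha : (d : ZMod m) * a = (h : ZMod m)) : ((m.gcd d : ℕ) : ℤ) ∣ h := by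
  obtain ⟨a, rfl⟩ := ZMod.intCast_surjective a
  have hm : (m : ℤ) ∣ h - d * a := by
    rw [← ZMod.intCast_eq_intCast_iff_dvd_sub]
    push_cast
    exact ha
  have h1 : ((m.gcd d : ℕ) : ℤ) ∣ h - d * a :=
    (Int.natCast_dvd_natCast.2 (Nat.gcd_dvd_left m d)).trans hm
  have h2 : ((m.gcd d : ℕ) : ℤ) ∣ d * a :=
    (Int.natCast_dvd_natCast.2 (Nat.gcd_dvd_right m d)).mul_right a
  exact (Int.dvd_iff_dvd_of_dvd_sub h1).2 h2

theorem Fin.prod_ite_lt_eq {n s : ℕ} (hs : s ≤ n) (f : ℕ → ℕ) (m : ℕ) :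
    ∏ k : Fin n, (if (k : ℕ) < s then f k else m) = m ^ (n - s) * ∏ j ∈ range s, f j := by
  rw [Fin.prod_univ_eq_prod_range (fun k => if k < s then f k else m) n]
  obtain ⟨l, rfl⟩ := Nat.exists_eq_add_of_le hs
  rw [prod_range_add, mul_comm, Nat.add_sub_cancel_left]
  congr 1
  · simp
  · exact prod_congr rfl fun j hj => if_pos (mem_range.1 hj)

theorem Matrix.mulVec_bijective_of_isUnit_det {ι R : Type*} [Fintype ι] [DecidableEq ι]
    [CommRing R] (A : Matrix ι ι R) (hA : IsUnit A.det) : Function.Bijective A.mulVec := by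
  refine Function.bijective_iff_has_inverse.2 ⟨A⁻¹.mulVec, fun v => ?_, fun v => ?_⟩
  · rw [Matrix.mulVec_mulVec, Matrix.nonsing_inv_mul A hA, Matrix.one_mulVec]
  · rw [Matrix.mulVec_mulVec, Matrix.mul_nonsing_inv A hA, Matrix.one_mulVec]

theorem IsSmithDatum.card_linear_fiber {ρ n : ℕ} {M : Matrix (Fin ρ) (Fin n) ℤ}
    {U : Matrix (Fin ρ) (Fin ρ) ℤ} {V : Matrix (Fin n) (Fin n) ℤ} {s : ℕ} {d : ℕ → ℕ}
    (hM : IsSmithDatum M U V s d) (m : ℕ) [NeZero m] (w : Fin ρ → ℤ)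
    [Decidable (IndexCond m U s d w)] :
    Nat.card {t : Fin n → ZMod m //
      (M.map (Int.cast : ℤ → ZMod m)).mulVec t = fun i => (w i : ZMod m)} =
      if IndexCond m U s d w then m ^ (n - s) * ∏ j ∈ range s, m.gcd (d j) else 0 := by
  obtain ⟨hU, hV, hsρ, hsn, -, -, hD⟩ := hM
  set c := Int.castRingHom (ZMod m)
  have hdet : ∀ {k : ℕ} (A : Matrix (Fin k) (Fin k) ℤ), IsUnit A.det →
      IsUnit (A.map c).det := fun A hA => by
    rw [← RingHom.mapMatrix_apply, ← RingHom.map_det]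
    exact hA.map c
  have hUb := Matrix.mulVec_bijective_of_isUnit_det _ (hdet U hU)
  have hVb := Matrix.mulVec_bijective_of_isUnit_det _ (hdet V hV)
  have hUw : ∀ i, (U.map c).mulVec (fun i => (w i : ZMod m)) i = ((U.mulVec w i : ℤ) : ZMod m) := by
    intro i
    simp [Matrix.mulVec, dotProduct, c]
  have hDz : ∀ z i, (U.map c).mulVec ((M.map c).mulVec ((V.map c).mulVec z)) i =
      if h : (i : ℕ) < s then (d i : ZMod m) * z ⟨i, h.trans_le hsn⟩ else 0 := by
    intro z i
    rw [Matrix.mulVec_mulVec, Matrix.mulVec_mulVec, ← Matrix.map_mul,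
      ← Matrix.map_mul]
    simp only [Matrix.mulVec, dotProduct, Matrix.map_apply, hD]
    split_ifs with h
    · rw [sum_eq_single ⟨i, h.trans_le hsn⟩]
      · simp [h, c]
      · intro b _ hb
        have : (i : ℕ) ≠ b := fun hib => hb (Fin.ext hib.symm)
        simp [this]
      · simp
    · simp [h]
  have key : ∀ z, (M.map c).mulVec ((V.map c).mulVec z) = (fun i => (w i : ZMod m)) ↔
      ∀ i : Fin ρ, (if h : (i : ℕ) < s then (d i : ZMod m) * z ⟨i, h.trans_le hsn⟩ else 0) =
        ((U.mulVec w i : ℤ) : ZMod m) := by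
    intro z
    rw [← hUb.1.eq_iff, funext_iff]
    simp only [hDz, hUw]
  change Nat.card {t : Fin n → ZMod m // (M.map c).mulVec t = fun i => (w i : ZMod m)} = _
  rw [← Nat.card_congr ((Equiv.ofBijective _ hVb).subtypeEquiv fun z => (Iff.rfl :
    (M.map c).mulVec ((V.map c).mulVec z) = (fun i => (w i : ZMod m)) ↔ _))]
  simp only [key]
  split_ifs with hI
  · have hiff : ∀ z : Fin n → ZMod m, (∀ i : Fin ρ,
        (if h : (i : ℕ) < s then (d i : ZMod m) * z ⟨i, h.trans_le hsn⟩ else 0) =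
        ((U.mulVec w i : ℤ) : ZMod m)) ↔ ∀ k : Fin n, ∀ h : (k : ℕ) < s,
        (d k : ZMod m) * z k = ((U.mulVec w ⟨k, h.trans_le hsρ⟩ : ℤ) : ZMod m) := by
      intro z
      constructor
      · intro H k hk
        simpa [hk] using H ⟨k, hk.trans_le hsρ⟩
      · intro H i
        split_ifs with h
        · exact H ⟨i, h.trans_le hsn⟩ h
        · have := hI i
          rw [if_neg h] at this
          exact ((ZMod.intCast_zmod_eq_zero_iff_dvd _ _).2 this).symm
    simp only [hiff]
    rw [Nat.card_congr (Equiv.subtypePiEquivPi (p := fun (k : Fin n) (a : ZMod m) =>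
      ∀ h : (k : ℕ) < s, (d k : ZMod m) * a = ((U.mulVec w ⟨k, h.trans_le hsρ⟩ : ℤ) : ZMod m))),
      Nat.card_pi, ← Fin.prod_ite_lt_eq hsn]
    refine prod_congr rfl fun k _ => ?_
    split_ifs with hk
    · have := hI ⟨k, hk.trans_le hsρ⟩
      rw [if_pos hk] at this
      simpa [hk] using ZMod.card_natCast_mul_eq_intCast m (d k) _ this
    · simp [hk]
  · rw [Nat.card_eq_zero]
    refine Or.inl ⟨fun ⟨z, hz⟩ => hI fun i => ?_⟩
    have := hz i
    split_ifs at this ⊢ with h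
    · exact ZMod.gcd_dvd_of_natCast_mul_eq _ _ _ _ this
    · exact (ZMod.intCast_zmod_eq_zero_iff_dvd _ _).1 this.symm

theorem IsSmithDatum.le_of_columns_eq_zero {ρ n : ℕ} {M : Matrix (Fin ρ) (Fin n) ℤ}
    {U : Matrix (Fin ρ) (Fin ρ) ℤ} {V : Matrix (Fin n) (Fin n) ℤ} {s : ℕ} {d : ℕ → ℕ}
    (hM : IsSmithDatum M U V s d) {p : ℕ} (hp : p ≤ n)
    (hz : ∀ i (k : Fin n), p ≤ (k : ℕ) → M i k = 0) : s ≤ p := by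
  obtain ⟨-, -, hsρ, hsn, hd, -, hD⟩ := hM
  set A : Matrix (Fin ρ) (Fin p) ℤ := M.submatrix id (Fin.castLE hp)
  set B : Matrix (Fin p) (Fin n) ℤ := V.submatrix (Fin.castLE hp) id
  have hfac : M * V = A * B := by
    ext i k
    obtain ⟨l, rfl⟩ := Nat.exists_eq_add_of_le hp
    rw [Matrix.mul_apply, Matrix.mul_apply, Fin.sum_univ_add]
    rw [add_eq_left.2 (sum_eq_zero fun j _ => by rw [hz _ _ (by simp), zero_mul])]
    rfl
  have hdiag : Matrix.diagonal (fun j : Fin s => (d j : ℤ)) =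
      (U * A).submatrix (Fin.castLE hsρ) id * B.submatrix id (Fin.castLE hsn) := by
    have : (U * A).submatrix (Fin.castLE hsρ) id * B.submatrix id (Fin.castLE hsn) =
        (U * M * V).submatrix (Fin.castLE hsρ) (Fin.castLE hsn) := by
      rw [Matrix.mul_assoc U M V, hfac, ← Matrix.mul_assoc]
      rfl
    rw [this]
    ext i k
    simp [Matrix.diagonal_apply, hD, Fin.ext_iff]
  refine le_of_fin_injective ℤ (B.submatrix id (Fin.castLE hsn)).mulVecLin fun v v' hv => ?_
  have hv' := congrArg ((U * A).submatrix (Fin.castLE hsρ) id).mulVec hv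
  simp only [Matrix.mulVecLin_apply, Matrix.mulVec_mulVec, ← hdiag] at hv'
  funext j
  have hj := congrFun hv' j
  rw [Matrix.mulVec_diagonal, Matrix.mulVec_diagonal] at hj
  exact mul_left_cancel₀ (by exact_mod_cast (hd j j.2).ne') hj

theorem IsSmithDatum.card_monomial_preimage {G : Type*} [CommGroup G] [Finite G] {α : G}
    (hα : ∀ β : G, β ∈ Subgroup.zpowers α) {ind : G → ℕ} (hind : ∀ β, α ^ ind β = β)
    {ρ n : ℕ} {M : Matrix (Fin ρ) (Fin n) ℤ}
    {U : Matrix (Fin ρ) (Fin ρ) ℤ} {V : Matrix (Fin n) (Fin n) ℤ} {s : ℕ} {d : ℕ → ℕ}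
    (hM : IsSmithDatum M U V s d) {m : ℕ} (hm : m = Nat.card G) (P : (Fin ρ → G) → Prop) :
    Nat.card {y : Fin n → G // P fun i => ∏ j, y j ^ M i j} =
      Nat.card {u : Fin ρ → G // P u ∧ IndexCond m U s d fun i => (ind (u i) : ℤ)} *
        (m ^ (n - s) * ∏ j ∈ range s, m.gcd (d j)) := by
  classical
  have : NeZero m := ⟨hm ▸ Nat.card_pos.ne'⟩
  have : Fintype G := Fintype.ofFinite G
  set e : G ≃ ZMod m :=
    (zmodMulEquivOfGenerator hα hm.symm).symm.toEquiv.trans Multiplicative.toAdd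
  have he_zpow : ∀ x (k : ℤ), e (x ^ k) = k * e x := fun x k => by simp [e]
  have he_prod : ∀ (f : Fin n → G), e (∏ j, f j) = ∑ j, e (f j) := fun f => by simp [e]
  have he_ind : ∀ β, e β = (ind β : ZMod m) := fun β => by
    have h := zmodMulEquivOfGenerator_symm_apply_zpow hα hm.symm (ind β)
    rw [zpow_natCast, hind] at h
    simp [e, h]
  have hfiber : ∀ u : Fin ρ → G, Nat.card {y : Fin n → G // (fun i => ∏ j, y j ^ M i j) = u} =
      if IndexCond m U s d fun i => (ind (u i) : ℤ) then
        m ^ (n - s) * ∏ j ∈ range s, m.gcd (d j) else 0 := by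
    intro u
    rw [← hM.card_linear_fiber]
    refine Nat.card_congr ((Equiv.piCongrRight fun _ => e).subtypeEquiv fun y => ?_)
    simp only [funext_iff]
    refine forall_congr' fun i => ?_
    rw [← e.injective.eq_iff, he_prod, he_ind (u i)]
    simp [he_zpow, Matrix.mulVec, dotProduct]
  rw [← Nat.card_congr (Equiv.sigmaSubtypeFiberEquivSubtype (q := P)
    (fun y : Fin n → G => fun i => ∏ j, y j ^ M i j) fun y => Iff.rfl), Nat.card_sigma]
  simp only [hfiber]
  rw [← sum_filter, sum_const, smul_eq_mul, ← Fintype.card_subtype, ← Nat.card_eq_fintype_card,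
    Nat.card_congr (Equiv.subtypeSubtypeEquivSubtypeInter P
      fun u => IndexCond m U s d fun i => (ind (u i) : ℤ))]

theorem IsSmithDatum.card_monomial_preimage_castLE {G : Type*} [CommGroup G] [Finite G] {α : G}
    (hα : ∀ β : G, β ∈ Subgroup.zpowers α) {ind : G → ℕ} (hind : ∀ β, α ^ ind β = β)
    {ρ n : ℕ} {M : Matrix (Fin ρ) (Fin n) ℤ}
    {U : Matrix (Fin ρ) (Fin ρ) ℤ} {V : Matrix (Fin n) (Fin n) ℤ} {s : ℕ} {d : ℕ → ℕ}
    (hM : IsSmithDatum M U V s d) {m : ℕ} (hm : m = Nat.card G) (P : (Fin ρ → G) → Prop)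
    {p : ℕ} (hp : p ≤ n) (hz : ∀ i (k : Fin n), p ≤ (k : ℕ) → M i k = 0) :
    Nat.card {y : Fin p → G // P fun i => ∏ j, y j ^ M i (Fin.castLE hp j)} =
      Nat.card {u : Fin ρ → G // P u ∧ IndexCond m U s d fun i => (ind (u i) : ℤ)} *
        m ^ (p - s) * ∏ j ∈ range s, m.gcd (d j) := by
  have hsp := hM.le_of_columns_eq_zero hp hz
  have hfull := hM.card_monomial_preimage hα hind hm P
  obtain ⟨l, rfl⟩ := Nat.exists_eq_add_of_le hp
  have hsplit : Nat.card {y : Fin (p + l) → G // P fun i => ∏ j, y j ^ M i j} =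
      Nat.card {y : Fin p → G // P fun i => ∏ j, y j ^ M i (Fin.castLE hp j)} * m ^ l := by
    have hl : Nat.card (Fin l → G) = m ^ l := by rw [Nat.card_fun, Nat.card_fin, hm]
    rw [← hl, ← Nat.card_prod]
    refine (Nat.card_congr ((Equiv.prodSubtypeFstEquivSubtypeProd
      (β := Fin l → G)).symm.trans ((Fin.appendEquiv p l).subtypeEquiv fun y => ?_))).symm
    have : ∀ i, ∏ j, (Fin.append y.1 y.2) j ^ M i j =
        ∏ j, y.1 j ^ M i (Fin.castLE hp j) := by
      intro i
      rw [Fin.prod_univ_add, prod_eq_one (s := univ) (f := fun j : Fin l => _), mul_one]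
      · simp only [Fin.append_left]
        rfl
      · intro j _
        rw [hz _ _ (by simp), zpow_zero]
    simp [Fin.appendEquiv, this]
  have hm0 : 0 < m := hm ▸ Nat.card_pos
  refine Nat.eq_of_mul_eq_mul_right (pow_pos hm0 l) ?_
  rw [← hsplit, hfull, show p + l - s = (p - s) + l by omega, pow_add]
  ring

theorem append_eq_append_imp {β : Type*} {k l : ℕ} {f f' : Fin k → β} {g g' : Fin l → β}
    (h : Fin.append f g = Fin.append f' g') : f = f' ∧ g = g' :=
  Prod.mk.inj ((Fin.appendEquiv k l).injective (a₁ := (f, g)) (a₂ := (f', g')) h)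

theorem card_exists_eq_zero {F : Type*} [Field F] [Fintype F] (k : ℕ) :
    Nat.card {z : Fin k → F // ∃ j, z j = 0} =
      Fintype.card F ^ k - (Fintype.card F - 1) ^ k := by
  classical
  have hc : Nat.card {z : Fin k → F // ∀ j, z j ≠ 0} = (Fintype.card F - 1) ^ k := by
    rw [Nat.card_congr (Equiv.subtypePiEquivPi (p := fun (_ : Fin k) (a : F) => a ≠ 0)),
      Nat.card_pi]
    simp [Fintype.card_subtype_compl]
  have hadd : Nat.card {z : Fin k → F // ∀ j, z j ≠ 0} +
      Nat.card {z : Fin k → F // ¬ ∀ j, z j ≠ 0} = Fintype.card F ^ k := by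
    rw [← Nat.card_sum, Nat.card_congr (Equiv.sumCompl _), Nat.card_fun, Nat.card_fin,
      Nat.card_eq_fintype_card]
  simp only [not_forall, not_not] at hadd
  omega

/-- The number of points whose coordinates before `p` are nonzero and satisfy `Q`, and which have
a zero coordinate before `p'`. -/
theorem card_first_zero_block {F : Type*} [Field F] [Fintype F] {n p p' : ℕ} (hp : p ≤ p')
    (hn : p' ≤ n) (R : (Fin n → F) → Prop) (Q : (Fin p → Fˣ) → Prop)
    (hR : ∀ (x : Fin n → F) (y : Fin p → Fˣ), (∀ i, x (Fin.castLE (hp.trans hn) i) = y i) →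
      (∃ j : Fin n, (j : ℕ) < p' ∧ x j = 0) → (R x ↔ Q y)) :
    Nat.card {x : Fin n → F // R x ∧ (∀ j : Fin n, (j : ℕ) < p → x j ≠ 0) ∧
      ∃ j : Fin n, (j : ℕ) < p' ∧ x j = 0} =
      Fintype.card F ^ (n - p') *
        (Fintype.card F ^ (p' - p) - (Fintype.card F - 1) ^ (p' - p)) * Nat.card {y // Q y} := by
  obtain ⟨k, rfl⟩ := Nat.exists_eq_add_of_le hp
  rw [Nat.add_sub_cancel_left]
  obtain ⟨l, rfl⟩ := Nat.exists_eq_add_of_le hn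
  have hl : Fintype.card F ^ (p + k + l - (p + k)) = Nat.card (Fin l → F) := by
    simp
  rw [hl, ← card_exists_eq_zero, mul_comm _ (Nat.card {y // Q y}), mul_comm (Nat.card (Fin l → F)),
    ← mul_assoc, ← Nat.card_prod, ← Nat.card_prod]
  have hzero : ∀ (y : Fin p → Fˣ) (z : Fin k → F) (t : Fin l → F), (∃ j, z j = 0) →
      ∃ j : Fin (p + k + l), (j : ℕ) < p + k ∧
        Fin.append (Fin.append (fun i => (y i : F)) z) t j = 0 := by
    rintro y z t ⟨j, hj⟩
    exact ⟨Fin.castAdd l (Fin.natAdd p j), by simp, by simpa using hj⟩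
  have hleft : ∀ (y : Fin p → Fˣ) (z : Fin k → F) (t : Fin l → F) (i : Fin p),
      Fin.append (Fin.append (fun i => (y i : F)) z) t (Fin.castAdd l (Fin.castAdd k i)) = y i := by
    simp
  refine (Nat.card_eq_of_bijective (fun w : ({y : Fin p → Fˣ // Q y} ×
    {z : Fin k → F // ∃ j, z j = 0}) × (Fin l → F) =>
    (⟨Fin.append (Fin.append (fun i => (w.1.1.1 i : F)) w.1.2.1) w.2,
      (hR _ w.1.1.1 (hleft _ _ _) (hzero _ _ _ w.1.2.2)).2 w.1.1.2, ?_, hzero _ _ _ w.1.2.2⟩ :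
      {x : Fin (p + k + l) → F // R x ∧ (∀ j : Fin (p + k + l), (j : ℕ) < p → x j ≠ 0) ∧
      ∃ j : Fin (p + k + l), (j : ℕ) < p + k ∧ x j = 0})) ⟨?_, ?_⟩).symm
  · intro j hj
    have := hleft w.1.1.1 w.1.2.1 w.2 ⟨j, hj⟩
    rw [show Fin.castAdd l (Fin.castAdd k ⟨j, hj⟩) = j from rfl] at this
    rw [this]
    exact Units.ne_zero _
  · rintro ⟨⟨⟨y, hy⟩, ⟨z, hz⟩⟩, t⟩ ⟨⟨⟨y', hy'⟩, ⟨z', hz'⟩⟩, t'⟩ h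
    have happ : Fin.append (Fin.append (fun i => (y i : F)) z) t =
      Fin.append (Fin.append (fun i => (y' i : F)) z') t' := congrArg Subtype.val h
    obtain ⟨h12, h3⟩ := append_eq_append_imp happ
    obtain ⟨h1, h2⟩ := append_eq_append_imp h12
    have h1' : y = y' := funext fun i => Units.ext (congrFun h1 i)
    subst h1' h2 h3
    rfl
  · rintro ⟨x, hx, hne, j, hj, hj0⟩
    set y : Fin p → Fˣ := fun i => Units.mk0 (x (Fin.castAdd l (Fin.castAdd k i)))
      (hne _ (by simp))
    have hjp : p ≤ (j : ℕ) := not_lt.1 fun h => hne j h hj0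
    refine ⟨⟨⟨⟨y, (hR x y (fun i => rfl) ⟨j, hj, hj0⟩).1 hx⟩,
      ⟨fun i => x (Fin.castAdd l (Fin.natAdd p i)), ⟨(j : ℕ) - p, by omega⟩, ?_⟩⟩,
      fun i => x (Fin.natAdd (p + k) i)⟩, Subtype.ext ?_⟩
    · refine (congrArg x (Fin.ext ?_)).trans hj0
      simp only [Fin.val_castAdd, Fin.val_natAdd]
      omega
    · funext i
      refine Fin.addCases (fun i => ?_) (fun i => ?_) i
      · refine Fin.addCases (fun i => ?_) (fun i => ?_) i <;> simp [y]
      · simp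

theorem card_forall_ne_zero {F : Type*} [Field F] {n : ℕ}
    (R : (Fin n → F) → Prop) (Q : (Fin n → Fˣ) → Prop)
    (hR : ∀ (x : Fin n → F) (y : Fin n → Fˣ), (∀ i, x i = y i) → (R x ↔ Q y)) :
    Nat.card {x : Fin n → F // R x ∧ ∀ j : Fin n, (j : ℕ) < n → x j ≠ 0} =
      Nat.card {y // Q y} := by
  refine (Nat.card_eq_of_bijective (fun y : {y : Fin n → Fˣ // Q y} =>
    (⟨fun i => y.1 i, (hR _ y.1 fun _ => rfl).2 y.2, fun _ _ => Units.ne_zero _⟩ :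
      {x : Fin n → F // R x ∧ ∀ j : Fin n, (j : ℕ) < n → x j ≠ 0})) ⟨?_, ?_⟩).symm
  · intro y y' h
    exact Subtype.ext (funext fun i => Units.ext (congrFun (Subtype.mk.inj h) i))
  · rintro ⟨x, hx, hne⟩
    exact ⟨⟨fun i => Units.mk0 (x i) (hne i i.2), (hR x _ fun _ => rfl).1 hx⟩, rfl⟩

theorem card_split_first_zero {F : Type*} [Field F] [Finite F] {n p p' : ℕ} (hp : p ≤ p')
    (R : (Fin n → F) → Prop) :
    Nat.card {x : Fin n → F // R x ∧ ∀ j : Fin n, (j : ℕ) < p → x j ≠ 0} =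
      Nat.card {x : Fin n → F // R x ∧ (∀ j : Fin n, (j : ℕ) < p → x j ≠ 0) ∧
        ∃ j : Fin n, (j : ℕ) < p' ∧ x j = 0} +
      Nat.card {x : Fin n → F // R x ∧ ∀ j : Fin n, (j : ℕ) < p' → x j ≠ 0} := by
  classical
  rw [← Nat.card_congr (Equiv.sumCompl fun x : {x : Fin n → F //
    R x ∧ ∀ j : Fin n, (j : ℕ) < p → x j ≠ 0} => ∃ j : Fin n, (j : ℕ) < p' ∧ x.1 j = 0),
    Nat.card_sum]
  congr 1
  · rw [Nat.card_congr (Equiv.subtypeSubtypeEquivSubtypeInter _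
      fun x : Fin n → F => ∃ j : Fin n, (j : ℕ) < p' ∧ x j = 0)]
    simp only [and_assoc]
  · rw [Nat.card_congr (Equiv.subtypeSubtypeEquivSubtypeInter _
      fun x : Fin n → F => ¬ ∃ j : Fin n, (j : ℕ) < p' ∧ x j = 0)]
    refine Nat.card_congr (Equiv.subtypeEquivRight fun x => ?_)
    simp only [not_exists, not_and]
    exact ⟨fun h => ⟨h.1.1, h.2⟩, fun h => ⟨⟨h.1, fun j hj => h.2 j (hj.trans_le hp)⟩, h.2⟩⟩

/-- The value of a polynomial when the monomials of index at least `r` vanish and the others only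
involve the coordinates before `p`, which are units. -/
theorem sum_mul_monomial_eq {F : Type*} [Field F] {n p r r' : ℕ} (hp : p ≤ n) (hr : r ≤ r')
    (a : ℕ → Fˣ) (E : ℕ → ℕ → ℕ) (x : Fin n → F) (y : Fin p → Fˣ)
    (hxy : ∀ i, x (Fin.castLE hp i) = y i) (hz : ∀ i, i < r → ∀ j, p ≤ j → E i j = 0)
    (hpos : ∀ i, r ≤ i → i < r' → ∃ j : Fin n, x j = 0 ∧ 0 < E i j) :
    ∑ i ∈ range r', (a i : F) * ∏ j : Fin n, x j ^ E i (j : ℕ) =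
      ∑ i ∈ range r, (a i : F) * ((∏ j : Fin p, y j ^ (E i (j : ℕ) : ℤ) : Fˣ) : F) := by
  obtain ⟨k, rfl⟩ := Nat.exists_eq_add_of_le hr
  rw [sum_range_add, sum_eq_zero (s := range k), add_zero]
  · refine sum_congr rfl fun i hi => ?_
    obtain ⟨l, rfl⟩ := Nat.exists_eq_add_of_le hp
    rw [Fin.prod_univ_add, prod_eq_one (s := univ) (f := fun j : Fin l => _), mul_one,
      Units.coe_prod]
    · congr 1
      refine prod_congr rfl fun j _ => ?_
      rw [zpow_natCast, Units.val_pow_eq_pow_val, ← hxy]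
      rfl
    · intro j _
      rw [hz i (mem_range.1 hi) _ (by simp), pow_zero]
  · intro i hi
    obtain ⟨j, hj, hE⟩ := hpos (r + i) (by omega) (by simpa using hi)
    rw [prod_eq_zero (mem_univ j) (by rw [hj, zero_pow hE.ne']), mul_zero]

theorem sum_stackM_left {F : Type*} [Field F] {n p r r' : ℕ} (hp : p ≤ n)
    (a : ℕ → Fˣ) (E E' : ℕ → ℕ → ℕ) (y : Fin p → Fˣ) :
    (∑ i : Fin (r + r'), if (i : ℕ) < r then
      (a i : F) * ((∏ j : Fin p, y j ^ stackM E E' r r' n i (Fin.castLE hp j) : Fˣ) : F) else 0) =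
      ∑ i ∈ range r, (a i : F) * ((∏ j : Fin p, y j ^ (E i (j : ℕ) : ℤ) : Fˣ) : F) := by
  rw [Fin.sum_univ_add, ← Fin.sum_univ_eq_sum_range
    (fun i => (a i : F) * ((∏ j : Fin p, y j ^ (E i (j : ℕ) : ℤ) : Fˣ) : F))]
  simp [stackM]

theorem sum_stackM_right {F : Type*} [Field F] {n p r r' : ℕ} (hp : p ≤ n)
    (a : ℕ → Fˣ) (E E' : ℕ → ℕ → ℕ) (y : Fin p → Fˣ) :
    (∑ i : Fin (r + r'), if r ≤ (i : ℕ) then (a ((i : ℕ) - r) : F) *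
      ((∏ j : Fin p, y j ^ stackM E E' r r' n i (Fin.castLE hp j) : Fˣ) : F) else 0) =
      ∑ i ∈ range r', (a i : F) * ((∏ j : Fin p, y j ^ (E' i (j : ℕ) : ℤ) : Fˣ) : F) := by
  rw [Fin.sum_univ_add, ← Fin.sum_univ_eq_sum_range
    (fun i => (a i : F) * ((∏ j : Fin p, y j ^ (E' i (j : ℕ) : ℤ) : Fˣ) : F))]
  simp [stackM, (Fin.is_lt _).not_ge]

theorem stackM_eq_zero {E E' : ℕ → ℕ → ℕ} {r r' n p : ℕ}
    (h : ∀ i, i < r → ∀ j, p ≤ j → E i j = 0) (h' : ∀ i, i < r' → ∀ j, p ≤ j → E' i j = 0)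
    (i : Fin (r + r')) (k : Fin n) (hk : p ≤ (k : ℕ)) : stackM E E' r r' n i k = 0 := by
  simp only [stackM, Matrix.of_apply]
  split_ifs with hi
  · exact_mod_cast h _ hi _ hk
  · exact_mod_cast h' _ (by omega) _ hk

theorem rational_points_case_n1_lt_n3_n4_lt_n2
    (F : Type) [Field F] [Fintype F] [DecidableEq F]
    (q : ℕ) (hq : q = Fintype.card F)
    (hqpow : ∃ p k : ℕ, Nat.Prime p ∧ Odd p ∧ 0 < k ∧ q = p ^ k)
    (α : Fˣ) (hα : ∀ β : Fˣ, β ∈ Subgroup.zpowers α)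
    (ind : Fˣ → ℕ)
    (hind : ∀ β : Fˣ, 1 ≤ ind β ∧ ind β ≤ q - 1 ∧ α ^ ind β = β)
    (r₁ r₂ r₃ r₄ n₁ n₂ n₃ n₄ : ℕ)
    (hr₁ : 0 < r₁) (hr₁₂ : r₁ < r₂) (hr₃ : 0 < r₃) (hr₃₄ : r₃ < r₄)
    (hn₁ : 0 < n₁) (hn₁₂ : n₁ < n₂) (hn₃ : 0 < n₃) (hn₃₄ : n₃ < n₄)
    (hn₁₃ : n₁ ≤ n₃)
    (b₁ b₂ : F) (a₁ a₂ : ℕ → Fˣ)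
    (E₁ E₂ : ℕ → ℕ → ℕ)
    (hE₁p : ∀ i, i < r₁ → ∀ j, j < n₁ → 0 < E₁ i j)
    (hE₁z : ∀ i, i < r₁ → ∀ j, n₁ ≤ j → E₁ i j = 0)
    (hE₁p' : ∀ i, r₁ ≤ i → i < r₂ → ∀ j, j < n₂ → 0 < E₁ i j)
    (hE₁z' : ∀ i, r₁ ≤ i → i < r₂ → ∀ j, n₂ ≤ j → E₁ i j = 0)
    (hE₂p : ∀ i, i < r₃ → ∀ j, j < n₃ → 0 < E₂ i j)
    (hE₂z : ∀ i, i < r₃ → ∀ j, n₃ ≤ j → E₂ i j = 0)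
    (hE₂p' : ∀ i, r₃ ≤ i → i < r₄ → ∀ j, j < n₄ → 0 < E₂ i j)
    (hE₂z' : ∀ i, r₃ ≤ i → i < r₄ → ∀ j, n₄ ≤ j → E₂ i j = 0)
    (h₁₃ : n₁ < n₃) (h₄₂ : n₄ < n₂)
    (U₁ : Matrix (Fin (r₁)) (Fin (r₁)) ℤ) (V₁ : Matrix (Fin (n₂)) (Fin (n₂)) ℤ)
    (s₁ : ℕ) (d₁ : ℕ → ℕ)
    (hSD₁ : IsSmithDatum ((Matrix.of fun (i : Fin (r₁)) (j : Fin (n₂)) => (E₁ (i : ℕ) (j : ℕ) : ℤ))) U₁ V₁ s₁ d₁)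
    (U₃ : Matrix (Fin (r₁ + r₃)) (Fin (r₁ + r₃)) ℤ) (V₃ : Matrix (Fin (n₂)) (Fin (n₂)) ℤ)
    (s₃ : ℕ) (d₃ : ℕ → ℕ)
    (hSD₃ : IsSmithDatum (stackM E₁ E₂ r₁ r₃ n₂) U₃ V₃ s₃ d₃)
    (U₂ : Matrix (Fin (r₂ + r₄)) (Fin (r₂ + r₄)) ℤ) (V₂ : Matrix (Fin (n₂)) (Fin (n₂)) ℤ)
    (s₂ : ℕ) (d₂ : ℕ → ℕ)
    (hSD₂ : IsSmithDatum (stackM E₁ E₂ r₂ r₄ n₂) U₂ V₂ s₂ d₂)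
    (U₄ : Matrix (Fin (r₁ + r₄)) (Fin (r₁ + r₄)) ℤ) (V₄ : Matrix (Fin (n₂)) (Fin (n₂)) ℤ)
    (s₄ : ℕ) (d₄ : ℕ → ℕ)
    (hSD₄ : IsSmithDatum (stackM E₁ E₂ r₁ r₄ n₂) U₄ V₄ s₄ d₄)
    (H₁ : ℕ)
    (hH₁ : H₁ = Nat.card {u : Fin (r₁) → Fˣ //
      (∑ i : Fin (r₁), (a₁ (i : ℕ) : F) * ((u i : F))) = b₁ ∧
      IndexCond (q - 1) U₁ s₁ d₁ fun i => (ind (u i) : ℤ)})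
    (H₃ : ℕ)
    (hH₃ : H₃ = Nat.card {w : Fin (r₁ + r₃) → Fˣ //
      (∑ i : Fin (r₁ + r₃), if (i : ℕ) < r₁ then (a₁ (i : ℕ) : F) * ((w i : F)) else 0) = b₁ ∧
      (∑ i : Fin (r₁ + r₃), if r₁ ≤ (i : ℕ) then (a₂ ((i : ℕ) - r₁) : F) * ((w i : F)) else 0) = b₂ ∧
      IndexCond (q - 1) U₃ s₃ d₃ fun i => (ind (w i) : ℤ)})
    (H₂ : ℕ)
    (hH₂ : H₂ = Nat.card {w : Fin (r₂ + r₄) → Fˣ //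
      (∑ i : Fin (r₂ + r₄), if (i : ℕ) < r₂ then (a₁ (i : ℕ) : F) * ((w i : F)) else 0) = b₁ ∧
      (∑ i : Fin (r₂ + r₄), if r₂ ≤ (i : ℕ) then (a₂ ((i : ℕ) - r₂) : F) * ((w i : F)) else 0) = b₂ ∧
      IndexCond (q - 1) U₂ s₂ d₂ fun i => (ind (w i) : ℤ)})
    (H₄ : ℕ)
    (hH₄ : H₄ = Nat.card {w : Fin (r₁ + r₄) → Fˣ //
      (∑ i : Fin (r₁ + r₄), if (i : ℕ) < r₁ then (a₁ (i : ℕ) : F) * ((w i : F)) else 0) = b₁ ∧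
      (∑ i : Fin (r₁ + r₄), if r₁ ≤ (i : ℕ) then (a₂ ((i : ℕ) - r₁) : F) * ((w i : F)) else 0) = b₂ ∧
      IndexCond (q - 1) U₄ s₄ d₄ fun i => (ind (w i) : ℤ)})
    (L₁ : ℕ)
    (hL₁ : L₁ = H₁ * (q - 1) ^ (n₁ - s₁) * ∏ j ∈ Finset.range s₁, Nat.gcd (q - 1) (d₁ j))
    (L₂ : ℕ)
    (hL₂ : L₂ = H₂ * (q - 1) ^ (n₂ - s₂) * ∏ j ∈ Finset.range s₂, Nat.gcd (q - 1) (d₂ j))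
    (L₃ : ℕ)
    (hL₃ : L₃ = H₃ * (q - 1) ^ (n₃ - s₃) * ∏ j ∈ Finset.range s₃, Nat.gcd (q - 1) (d₃ j))
    (L₄ : ℕ)
    (hL₄ : L₄ = H₄ * (q - 1) ^ (n₄ - s₄) * ∏ j ∈ Finset.range s₄, Nat.gcd (q - 1) (d₄ j))
    :
    Nat.card {x : Fin (n₂) → F //
      (∑ i ∈ Finset.range r₂, (a₁ i : F) * ∏ j : Fin (n₂), x j ^ E₁ i (j : ℕ)) = b₁ ∧
      (∑ i ∈ Finset.range r₄, (a₂ i : F) * ∏ j : Fin (n₂), x j ^ E₂ i (j : ℕ)) = b₂} =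
      (if b₁ = 0 ∧ b₂ = 0 then q ^ (n₂ - n₁) * (q ^ n₁ - (q - 1) ^ n₁) else 0) +
      (if b₂ = 0 then q ^ (n₂ - n₃) * (q ^ (n₃ - n₁) - (q - 1) ^ (n₃ - n₁)) * L₁ else 0) +
      q ^ (n₂ - n₄) * (q ^ (n₄ - n₃) - (q - 1) ^ (n₄ - n₃)) * L₃ +
      L₂ +
      (q ^ (n₂ - n₄) - (q - 1) ^ (n₂ - n₄)) * L₄ := by
  subst hq
  have hm : Fintype.card F - 1 = Nat.card Fˣ := by
    rw [Nat.card_eq_fintype_card, Fintype.card_units]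
  have hind' : ∀ β, α ^ ind β = β := fun β => (hind β).2.2
  set R : (Fin n₂ → F) → Prop := fun x =>
    (∑ i ∈ Finset.range r₂, (a₁ i : F) * ∏ j : Fin (n₂), x j ^ E₁ i (j : ℕ)) = b₁ ∧
      (∑ i ∈ Finset.range r₄, (a₂ i : F) * ∏ j : Fin (n₂), x j ^ E₂ i (j : ℕ)) = b₂
  have hn₃₂ : n₃ ≤ n₂ := (hn₃₄.trans h₄₂).le
  have hz₁ : ∀ p, n₁ ≤ p → ∀ i, i < r₁ → ∀ j, p ≤ j → E₁ i j = 0 :=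
    fun p hp i hi j hj => hE₁z i hi j (hp.trans hj)
  have hz₂ : ∀ i, i < r₂ → ∀ j, n₂ ≤ j → E₁ i j = 0 := fun i hi j hj =>
    (lt_or_ge i r₁).elim (fun h => hE₁z i h j (hn₁₂.le.trans hj)) fun h => hE₁z' i h hi j hj
  have hz₄ : ∀ p, n₄ ≤ p → ∀ i, i < r₄ → ∀ j, p ≤ j → E₂ i j = 0 := fun p hp i hi j hj =>
    (lt_or_ge i r₃).elim (fun h => hE₂z i h j (hn₃₄.le.trans (hp.trans hj)))
      fun h => hE₂z' i h hi j (hp.trans hj)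
  have hpos₁ : ∀ i, i < r₂ → ∀ j, j < n₁ → 0 < E₁ i j := fun i hi j hj =>
    (lt_or_ge i r₁).elim (fun h => hE₁p i h j hj) fun h => hE₁p' i h hi j (hj.trans hn₁₂)
  have hpos₂ : ∀ i, i < r₄ → ∀ j, j < n₃ → 0 < E₂ i j := fun i hi j hj =>
    (lt_or_ge i r₃).elim (fun h => hE₂p i h j hj) fun h => hE₂p' i h hi j (hj.trans hn₃₄)
  have hL₁' := hSD₁.card_monomial_preimage_castLE hα hind' hm
    (fun u => ∑ i : Fin r₁, (a₁ (i : ℕ) : F) * (u i : F) = b₁) hn₁₂.le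
    fun i k hk => by simpa using hE₁z i i.2 k hk
  have hL₃' := hSD₃.card_monomial_preimage_castLE hα hind' hm
    (fun w => (∑ i : Fin (r₁ + r₃), if (i : ℕ) < r₁ then
        (a₁ (i : ℕ) : F) * ((w i : F)) else 0) = b₁ ∧
      (∑ i : Fin (r₁ + r₃), if r₁ ≤ (i : ℕ) then
        (a₂ ((i : ℕ) - r₁) : F) * ((w i : F)) else 0) = b₂)
    hn₃₂ (stackM_eq_zero (hz₁ n₃ hn₁₃) hE₂z)
  have hL₄' := hSD₄.card_monomial_preimage_castLE hα hind' hm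
    (fun w => (∑ i : Fin (r₁ + r₄), if (i : ℕ) < r₁ then
        (a₁ (i : ℕ) : F) * ((w i : F)) else 0) = b₁ ∧
      (∑ i : Fin (r₁ + r₄), if r₁ ≤ (i : ℕ) then
        (a₂ ((i : ℕ) - r₁) : F) * ((w i : F)) else 0) = b₂)
    h₄₂.le (stackM_eq_zero (hz₁ n₄ (hn₁₃.trans hn₃₄.le)) (hz₄ n₄ le_rfl))
  have hL₂' := hSD₂.card_monomial_preimage_castLE hα hind' hm
    (fun w => (∑ i : Fin (r₂ + r₄), if (i : ℕ) < r₂ then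
        (a₁ (i : ℕ) : F) * ((w i : F)) else 0) = b₁ ∧
      (∑ i : Fin (r₂ + r₄), if r₂ ≤ (i : ℕ) then
        (a₂ ((i : ℕ) - r₂) : F) * ((w i : F)) else 0) = b₂)
    le_rfl (stackM_eq_zero hz₂ (hz₄ n₂ h₄₂.le))
  simp only [and_assoc, sum_stackM_left, sum_stackM_right] at hL₂' hL₃' hL₄'
  rw [← hH₁, ← hL₁] at hL₁'
  rw [← hH₂, ← hL₂] at hL₂'
  rw [← hH₃, ← hL₃] at hL₃'
  rw [← hH₄, ← hL₄] at hL₄'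
  have hL₁'' : Nat.card {y : Fin n₁ → Fˣ // ∑ i ∈ range r₁, (a₁ i : F) *
      ((∏ j : Fin n₁, y j ^ (E₁ i (j : ℕ) : ℤ) : Fˣ) : F) = b₁} = L₁ := by
    rw [← hL₁']
    refine Nat.card_congr (Equiv.subtypeEquivRight fun y => ?_)
    rw [← Fin.sum_univ_eq_sum_range
      (fun i => (a₁ i : F) * ((∏ j : Fin n₁, y j ^ (E₁ i (j : ℕ) : ℤ) : Fˣ) : F))]
    rfl
  have hstart : Nat.card {x // R x} =
      Nat.card {x // R x ∧ ∀ j : Fin n₂, (j : ℕ) < 0 → x j ≠ 0} := by simp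
  have hblock₀ := card_first_zero_block (Nat.zero_le n₁) hn₁₂.le R (fun _ => b₁ = 0 ∧ b₂ = 0) <| by
    rintro x y hxy ⟨j, hj, hj0⟩
    simp only [R]
    rw [sum_mul_monomial_eq (Nat.zero_le _) (Nat.zero_le r₂) a₁ E₁ x y hxy (by simp)
        fun i _ hi => ⟨j, hj0, hpos₁ i hi j hj⟩,
      sum_mul_monomial_eq (Nat.zero_le _) (Nat.zero_le r₄) a₂ E₂ x y hxy (by simp)
        fun i _ hi => ⟨j, hj0, hpos₂ i hi j (hj.trans h₁₃)⟩]
    simp [eq_comm]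
  have hblock₁ := card_first_zero_block h₁₃.le hn₃₂ R (fun y => (∑ i ∈ range r₁, (a₁ i : F) *
      ((∏ j : Fin n₁, y j ^ (E₁ i (j : ℕ) : ℤ) : Fˣ) : F) = b₁) ∧ b₂ = 0) <| by
    rintro x y hxy ⟨j, hj, hj0⟩
    simp only [R]
    rw [sum_mul_monomial_eq hn₁₂.le hr₁₂.le a₁ E₁ x y hxy hE₁z
        fun i hi hi' => ⟨j, hj0, hE₁p' i hi hi' j j.2⟩,
      sum_mul_monomial_eq hn₁₂.le (Nat.zero_le r₄) a₂ E₂ x y hxy (by simp)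
        fun i _ hi => ⟨j, hj0, hpos₂ i hi j hj⟩]
    simp [eq_comm]
  have hblock₂ := card_first_zero_block hn₃₄.le h₄₂.le R (fun y => (∑ i ∈ range r₁, (a₁ i : F) *
      ((∏ j : Fin n₃, y j ^ (E₁ i (j : ℕ) : ℤ) : Fˣ) : F) = b₁) ∧ ∑ i ∈ range r₃, (a₂ i : F) *
      ((∏ j : Fin n₃, y j ^ (E₂ i (j : ℕ) : ℤ) : Fˣ) : F) = b₂) <| by
    rintro x y hxy ⟨j, hj, hj0⟩
    simp only [R]
    rw [sum_mul_monomial_eq hn₃₂ hr₁₂.le a₁ E₁ x y hxy (hz₁ n₃ hn₁₃)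
        fun i hi hi' => ⟨j, hj0, hE₁p' i hi hi' j j.2⟩,
      sum_mul_monomial_eq hn₃₂ hr₃₄.le a₂ E₂ x y hxy hE₂z
        fun i hi hi' => ⟨j, hj0, hE₂p' i hi hi' j hj⟩]
  have hblock₃ := card_first_zero_block h₄₂.le le_rfl R (fun y => (∑ i ∈ range r₁, (a₁ i : F) *
      ((∏ j : Fin n₄, y j ^ (E₁ i (j : ℕ) : ℤ) : Fˣ) : F) = b₁) ∧ ∑ i ∈ range r₄, (a₂ i : F) *
      ((∏ j : Fin n₄, y j ^ (E₂ i (j : ℕ) : ℤ) : Fˣ) : F) = b₂) <| by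
    rintro x y hxy ⟨j, hj, hj0⟩
    simp only [R]
    rw [sum_mul_monomial_eq h₄₂.le hr₁₂.le a₁ E₁ x y hxy (hz₁ n₄ (hn₁₃.trans hn₃₄.le))
        fun i hi hi' => ⟨j, hj0, hE₁p' i hi hi' j j.2⟩,
      sum_mul_monomial_eq h₄₂.le le_rfl a₂ E₂ x y hxy (hz₄ n₄ le_rfl)
        fun i hi hi' => absurd hi' hi.not_gt]
  have hblock₄ := card_forall_ne_zero R (fun y => (∑ i ∈ range r₂, (a₁ i : F) *
      ((∏ j : Fin n₂, y j ^ (E₁ i (j : ℕ) : ℤ) : Fˣ) : F) = b₁) ∧ ∑ i ∈ range r₄, (a₂ i : F) *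
      ((∏ j : Fin n₂, y j ^ (E₂ i (j : ℕ) : ℤ) : Fˣ) : F) = b₂) <| by
    intro x y hxy
    simp only [R]
    rw [sum_mul_monomial_eq le_rfl le_rfl a₁ E₁ x y hxy hz₂
        fun i hi hi' => absurd hi' hi.not_gt,
      sum_mul_monomial_eq le_rfl le_rfl a₂ E₂ x y hxy (hz₄ n₂ h₄₂.le)
        fun i hi hi' => absurd hi' hi.not_gt]
  rw [hL₃'] at hblock₂
  rw [hL₄'] at hblock₃
  rw [hL₂'] at hblock₄
  rw [hstart, card_split_first_zero (Nat.zero_le n₁), card_split_first_zero h₁₃.le,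
    card_split_first_zero hn₃₄.le, card_split_first_zero h₄₂.le, hblock₀, hblock₁, hblock₂,
    hblock₃, hblock₄, Nat.sub_zero, Nat.sub_self, pow_zero, one_mul]
  have hQ₀ : ∀ c : ℕ, c * Nat.card {_y : Fin 0 → Fˣ // b₁ = 0 ∧ b₂ = 0} =
      if b₁ = 0 ∧ b₂ = 0 then c else 0 := fun c => by
    split_ifs with h <;> simp [h]
  have hQ₁ : ∀ c : ℕ, c * Nat.card {y : Fin n₁ → Fˣ // ∑ i ∈ range r₁, (a₁ i : F) *
      ((∏ j : Fin n₁, y j ^ (E₁ i (j : ℕ) : ℤ) : Fˣ) : F) = b₁ ∧ b₂ = 0} =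
      if b₂ = 0 then c * L₁ else 0 := fun c => by
    split_ifs with h
    · simp only [h, and_true, hL₁'']
    · simp [h]
  rw [hQ₀, hQ₁]
  ring
end

section
/- Assume n_3 > n_2 (so n_1 < n_2 < n_3 < n_4 and n = n_4). Fix a Smith datum (U^{(1)}, V^{(1)}, d^{(1)}_1 | … | d^{(1)}_{s_1}) for E_{11}, a Smith datum (U^{(2)}, V^{(2)}, d^{(2)}_1 | … | d^{(2)}_{s_2}) for (E_{11}; E_{12}), a Smith datum (U^{(3)}, V^{(3)}, d^{(3)}_1 | … | d^{(3)}_{s_3}) for (E_{11}; E_{12}; E_{21}), and a Smith datum (U^{(4)}, V^{(4)}, d^{(4)}_1 | … | d^{(4)}_{s_4}) for (E_{11}; E_{12}; E_{21}; E_{22}). Define H_1 = #{(u_1,…,u_{r_1}) ∈ (F_q^*)^{r_1} : Σ_{i=1}^{r_1} a_{1,i} u_i = b_1 and u satisfies the index condition for (E_{11}, U^{(1)}, d^{(1)})}; H_2 = #{(u_1,…,u_{r_2}) ∈ (F_q^*)^{r_2} : Σ_{i=1}^{r_2} a_{1,i} u_i = b_1 and u satisfies the index condition for ((E_{11}; E_{12}),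 U^{(2)}, d^{(2)})}; H_3 = #{(u_1,…,u_{r_2}, v_1,…,v_{r_3}) ∈ (F_q^*)^{r_2+r_3} : Σ_{i=1}^{r_2} a_{1,i} u_i = b_1, Σ_{j=1}^{r_3} a_{2,j} v_j = b_2, and (u,v) satisfies the index condition for ((E_{11}; E_{12}; E_{21}), U^{(3)}, d^{(3)})}; H_4 = #{(u_1,…,u_{r_2}, v_1,…,v_{r_4}) ∈ (F_q^*)^{r_2+r_4} : Σ_{i=1}^{r_2} a_{1,i} u_i = b_1, Σ_{j=1}^{r_4} a_{2,j} v_j = b_2, and (u,v) satisfies the index condition for ((E_{11}; E_{12}; E_{21}; E_{22}), U^{(4)}, d^{(4)})}; and for l = 1,2,3,4 set L_l = H_l · (q−1)^{n_l − s_l} · ∏_{j=1}^{s_l} gcd(q−1, d^{(l)}_j). Then N = N_0 + N_1 + N_3 + N_4 + N_6, where N_0 = q^{n_4−n_1}(q^{n_1} − (q−1)^{n_1}) if b_1 = b_2 = 0 and N_0 = 0 otherwise; N_1 = q^{n_4−n_2}(q^{n_2−n_1} − (q−1)^{n_2−n_1}) L_1 if b_2 = 0 and N_1 = 0 otherwise;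 N_3 = (q^{n_4−n_3} − (q−1)^{n_4−n_3}) L_3; N_4 = L_4; and N_6 = q^{n_4−n_3}(q^{n_3−n_2} − (q−1)^{n_3−n_2}) L_2 if b_2 = 0 and N_6 = 0 otherwise. -/
open Finset

theorem ZMod.card_filter_mul_eq {m : ℕ} [NeZero m] (d : ℕ) (h : ℤ)
    (hd : ((m.gcd d : ℕ) : ℤ) ∣ h) :
    #{y : ZMod m | (d : ZMod m) * y = h} = m.gcd d := by
  obtain ⟨c, rfl⟩ := hd
  have hb := Nat.gcd_eq_gcd_ab m d
  set y₀ : ZMod m := ((m.gcdB d * c : ℤ) : ZMod m) with hy₀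
  have h0 : (d : ZMod m) * y₀ = (((m.gcd d : ℕ) : ℤ) * c : ℤ) := by
    rw [hb, hy₀]; push_cast; simp; ring
  rw [← h0]
  have hk := IsAddCyclic.card_nsmulAddMonoidHom_ker (ZMod m) d
  rw [Nat.card_zmod] at hk
  rw [← hk, Nat.card_eq_fintype_card, Fintype.card_subtype]
  refine Finset.card_nbij' (· - y₀) (· + y₀) ?_ ?_ ?_ ?_ <;>
    simp +contextual [Set.MapsTo, Set.LeftInvOn, AddMonoidHom.mem_ker, mul_sub, mul_add]

theorem dvd_of_natCast_mul_eq_intCast {m : ℕ} (d : ℕ) (h : ℤ) (y : ZMod m)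
    (hy : (d : ZMod m) * y = h) : ((m.gcd d : ℕ) : ℤ) ∣ h := by
  obtain ⟨z, rfl⟩ := ZMod.intCast_surjective y
  have : ((d * z - h : ℤ) : ZMod m) = 0 := by push_cast; rw [hy, sub_self]
  rw [ZMod.intCast_zmod_eq_zero_iff_dvd] at this
  have h1 : ((m.gcd d : ℕ) : ℤ) ∣ d * z - h :=
    (Int.natCast_dvd_natCast.2 (Nat.gcd_dvd_left m d)).trans this
  have h2 : ((m.gcd d : ℕ) : ℤ) ∣ d * z :=
    (Int.natCast_dvd_natCast.2 (Nat.gcd_dvd_right m d)).mul_right z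
  exact (dvd_sub_right h2).1 h1

theorem IsSmithDatum.le_of_cols_eq_zero {ρ n : ℕ} {M : Matrix (Fin ρ) (Fin n) ℤ}
    {U : Matrix (Fin ρ) (Fin ρ) ℤ} {V : Matrix (Fin n) (Fin n) ℤ} {s : ℕ} {d : ℕ → ℕ}
    (hM : IsSmithDatum M U V s d) {k : ℕ} (hk : k ≤ n)
    (h0 : ∀ i (j : Fin n), k ≤ (j : ℕ) → M i j = 0) : s ≤ k := by
  obtain ⟨-, -, hsρ, hsn, hd, -, hD⟩ := hM
  set A : Matrix (Fin s) (Fin k) ℤ := (U * M).submatrix (Fin.castLE hsρ) (Fin.castLE hk)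
  set B : Matrix (Fin k) (Fin s) ℤ := V.submatrix (Fin.castLE hk) (Fin.castLE hsn)
  have hAB : A * B = Matrix.diagonal fun i : Fin s => (d i : ℤ) := by
    ext i i'
    have h := hD (Fin.castLE hsρ i) (Fin.castLE hsn i')
    rw [Matrix.mul_apply] at h
    have hsum : ∑ j : Fin n, (U * M) (Fin.castLE hsρ i) j * V j (Fin.castLE hsn i') =
        (A * B) i i' := by
      rw [Matrix.mul_apply]
      refine (Fintype.sum_of_injective (Fin.castLE hk) (Fin.castLE_injective hk) _ _ ?_ ?_).symm
      · intro j hj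
        have hkj : k ≤ (j : ℕ) := by
          by_contra! hlt
          exact hj ⟨⟨j, hlt⟩, rfl⟩
        rw [Matrix.mul_apply, Finset.sum_eq_zero, zero_mul]
        intro l _
        rw [h0 l j hkj, mul_zero]
      · intro j
        rfl
    rw [← hsum, h, Matrix.diagonal_apply]
    simp [Fin.ext_iff]
  have hdet : (A * B).det ≠ 0 := by
    rw [hAB, Matrix.det_diagonal, Finset.prod_ne_zero_iff]
    intro i _
    exact_mod_cast (hd i i.2).ne'
  have hrank := Matrix.rank_of_det_ne_zero hdet
  rw [Fintype.card_fin] at hrank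
  calc s = (A * B).rank := hrank.symm
    _ ≤ A.rank := Matrix.rank_mul_le_left A B
    _ ≤ k := A.rank_le_width

theorem IsSmithDatum.card_filter_mulVec_eq {ρ n m : ℕ} [NeZero m]
    {M : Matrix (Fin ρ) (Fin n) ℤ}
    {U : Matrix (Fin ρ) (Fin ρ) ℤ} {V : Matrix (Fin n) (Fin n) ℤ} {s : ℕ} {d : ℕ → ℕ}
    (hM : IsSmithDatum M U V s d) (w : Fin ρ → ℤ) [Decidable (IndexCond m U s d w)] :
    #{x : Fin n → ZMod m | (M.map (Int.castRingHom (ZMod m))).mulVec x = fun i => (w i : ZMod m)} =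
      if IndexCond m U s d w then m ^ (n - s) * ∏ j ∈ range s, m.gcd (d j) else 0 := by
  obtain ⟨hU, hV, hsρ, hsn, -, -, hD⟩ := hM
  set φ := Int.castRingHom (ZMod m)
  have hUφ : IsUnit (U.map φ) :=
    ((Matrix.isUnit_iff_isUnit_det U).2 hU).map φ.mapMatrix
  have hVφ : IsUnit (V.map φ) :=
    ((Matrix.isUnit_iff_isUnit_det V).2 hV).map φ.mapMatrix
  have hsys (y : Fin n → ZMod m) :
      (M.map φ).mulVec ((V.map φ).mulVec y) = (fun i => (w i : ZMod m)) ↔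
        ∀ i : Fin ρ, (if hi : (i : ℕ) < s then (d i : ZMod m) * y ⟨i, hi.trans_le hsn⟩ else 0) =
          (U.mulVec w i : ℤ) := by
    rw [← (Matrix.mulVec_injective_of_isUnit hUφ).eq_iff, Matrix.mulVec_mulVec,
      Matrix.mulVec_mulVec, ← Matrix.map_mul, ← Matrix.map_mul, funext_iff]
    refine forall_congr' fun i => ?_
    have hr : (U.map φ).mulVec (fun i => (w i : ZMod m)) i = (U.mulVec w i : ℤ) :=
      (RingHom.map_mulVec φ U w i).symm
    have hl : ((U * M * V).map φ).mulVec y i =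
        if hi : (i : ℕ) < s then (d i : ZMod m) * y ⟨i, hi.trans_le hsn⟩ else 0 := by
      simp only [Matrix.mulVec, dotProduct, Matrix.map_apply, hD]
      split_ifs with hi
      · rw [Finset.sum_eq_single ⟨i, hi.trans_le hsn⟩]
        · simp [hi, φ]
        · intro k _ hk
          have : (i : ℕ) ≠ k := fun h => hk (Fin.ext h.symm)
          simp [this]
        · simp
      · simp [hi]
    rw [hl, hr]
  have hcard : #{x : Fin n → ZMod m | (M.map φ).mulVec x = fun i => (w i : ZMod m)} =
      #{y : Fin n → ZMod m | ∀ i : Fin ρ,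
        (if hi : (i : ℕ) < s then (d i : ZMod m) * y ⟨i, hi.trans_le hsn⟩ else 0) =
          (U.mulVec w i : ℤ)} := by
    symm
    refine Finset.card_bijective (V.map φ).mulVec ?_ ?_
    · exact Finite.injective_iff_bijective.1 (Matrix.mulVec_injective_of_isUnit hVφ)
    · intro y
      simp only [mem_filter_univ, hsys]
  rw [hcard]
  split_ifs with hI
  · have hset : ({y : Fin n → ZMod m | ∀ i : Fin ρ,
        (if hi : (i : ℕ) < s then (d i : ZMod m) * y ⟨i, hi.trans_le hsn⟩ else 0) =
          (U.mulVec w i : ℤ)} : Finset _) =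
        Fintype.piFinset fun j : Fin n => {z : ZMod m | ∀ hj : (j : ℕ) < s,
          (d j : ZMod m) * z = (U.mulVec w ⟨j, hj.trans_le hsρ⟩ : ℤ)} := by
      ext y
      simp only [mem_filter_univ, Fintype.mem_piFinset]
      constructor
      · intro h j hj
        have := h ⟨j, hj.trans_le hsρ⟩
        rwa [dif_pos hj] at this
      · intro h i
        split_ifs with hi
        · exact h ⟨i, hi.trans_le hsn⟩ hi
        · have := hI i
          rw [if_neg hi] at this
          exact ((ZMod.intCast_zmod_eq_zero_iff_dvd _ _).2 this).symm
    rw [hset, Fintype.card_piFinset]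
    have hfac (j : Fin n) : #{z : ZMod m | ∀ hj : (j : ℕ) < s,
        (d j : ZMod m) * z = (U.mulVec w ⟨j, hj.trans_le hsρ⟩ : ℤ)} =
          if (j : ℕ) < s then m.gcd (d j) else m := by
      split_ifs with hj
      · simp only [hj, forall_true_left]
        have := hI ⟨j, hj.trans_le hsρ⟩
        rw [if_pos hj] at this
        exact ZMod.card_filter_mul_eq _ _ this
      · simp [hj]
    rw [Finset.prod_congr rfl fun j _ => hfac j,
      ← Finset.prod_range (fun j => if j < s then m.gcd (d j) else m)]
    obtain ⟨t, rfl⟩ := Nat.exists_eq_add_of_le hsn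
    rw [Finset.prod_range_add, mul_comm]
    congr 1
    · simp
    · exact Finset.prod_congr rfl fun j hj => if_pos (mem_range.1 hj)
  · rw [Finset.card_eq_zero, Finset.filter_eq_empty_iff]
    intro y _ h
    refine hI fun i => ?_
    have hi := h i
    split_ifs at hi ⊢ with his
    · exact dvd_of_natCast_mul_eq_intCast _ _ _ hi
    · exact (ZMod.intCast_zmod_eq_zero_iff_dvd _ _).1 hi.symm

section Strata

variable {F : Type*} [Field F] [Fintype F] [DecidableEq F]

theorem card_filter_and_mul_card {ι A : Type*} [Fintype ι] [DecidableEq ι] [Fintype A]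
    (p : ι → Prop) [DecidablePred p] (P Q : (ι → A) → Prop) [DecidablePred P] [DecidablePred Q]
    (hP : ∀ x y, (∀ j, p j → x j = y j) → (P x ↔ P y))
    (hQ : ∀ x y, (∀ j, ¬ p j → x j = y j) → (Q x ↔ Q y)) :
    #{x | P x ∧ Q x} * Fintype.card (ι → A) = #{x | P x} * #{x | Q x} := by
  rw [← Finset.card_univ, ← Finset.card_product, ← Finset.card_product]
  set swap : (ι → A) × (ι → A) → (ι → A) × (ι → A) := fun z =>
    (fun j => if p j then z.1 j else z.2 j, fun j => if p j then z.2 j else z.1 j) with hswap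
  have hinv : Function.Involutive swap := by
    intro z
    ext j <;> by_cases hj : p j <;> simp [hswap, hj]
  refine Finset.card_bijective swap hinv.bijective fun z => ?_
  have h1 : P (swap z).1 ↔ P z.1 := hP _ _ fun j hj => by simp [hswap, hj]
  have h2 : Q (swap z).2 ↔ Q z.1 := hQ _ _ fun j hj => by simp [hswap, hj]
  simp [h1, h2]

theorem card_filter_ne_zero_on_Ico {n k k' : ℕ} (hk : k ≤ k') (hk' : k' ≤ n) :
    #{x : Fin n → F | ∀ j : Fin n, k ≤ (j : ℕ) → (j : ℕ) < k' → x j ≠ 0} =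
      Fintype.card F ^ k * (Fintype.card F - 1) ^ (k' - k) * Fintype.card F ^ (n - k') := by
  have hset : ({x : Fin n → F | ∀ j : Fin n, k ≤ (j : ℕ) → (j : ℕ) < k' → x j ≠ 0} : Finset _) =
      Fintype.piFinset fun j : Fin n =>
        {z : F | k ≤ (j : ℕ) → (j : ℕ) < k' → z ≠ 0} := by
    ext x
    simp [Fintype.mem_piFinset]
  have hfac (j : Fin n) : #{z : F | k ≤ (j : ℕ) → (j : ℕ) < k' → z ≠ 0} =
      if k ≤ (j : ℕ) ∧ (j : ℕ) < k' then Fintype.card F - 1 else Fintype.card F := by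
    split_ifs with hj
    · simp only [hj.1, hj.2, forall_true_left, Finset.filter_ne']
      rw [Finset.card_erase_of_mem (mem_univ _), Finset.card_univ]
    · rw [Finset.filter_true_of_mem, Finset.card_univ]
      intro z _ h1 h2
      exact absurd ⟨h1, h2⟩ hj
  rw [hset, Fintype.card_piFinset, Finset.prod_congr rfl fun j _ => hfac j,
    ← Finset.prod_range
      (fun j => if k ≤ j ∧ j < k' then Fintype.card F - 1 else Fintype.card F)]
  obtain ⟨a, rfl⟩ := Nat.exists_eq_add_of_le hk
  obtain ⟨b, rfl⟩ := Nat.exists_eq_add_of_le hk'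
  rw [Finset.prod_range_add, Finset.prod_range_add, Nat.add_sub_cancel_left,
    Nat.add_sub_cancel_left]
  congr 1
  · congr 1
    · rw [Finset.prod_congr rfl fun j hj => if_neg (by have := mem_range.1 hj; omega)]
      simp
    · rw [Finset.prod_congr rfl fun j hj => if_pos (by have := mem_range.1 hj; omega)]
      simp
  · simp

theorem card_filter_exists_eq_zero_on_Ico {n k k' : ℕ} (hk : k ≤ k') (hk' : k' ≤ n) :
    #{x : Fin n → F | ∃ j : Fin n, k ≤ (j : ℕ) ∧ (j : ℕ) < k' ∧ x j = 0} =
      Fintype.card F ^ k * (Fintype.card F ^ (k' - k) - (Fintype.card F - 1) ^ (k' - k)) *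
        Fintype.card F ^ (n - k') := by
  have h := Finset.card_filter_add_card_filter_not (s := (univ : Finset (Fin n → F)))
    (fun x => ∃ j : Fin n, k ≤ (j : ℕ) ∧ (j : ℕ) < k' ∧ x j = 0)
  push Not at h
  rw [card_filter_ne_zero_on_Ico hk hk', Finset.card_univ, Fintype.card_fun, Fintype.card_fin] at h
  rw [Nat.mul_sub, Nat.sub_mul, ← pow_add, ← pow_add,
    show k + (k' - k) + (n - k') = n by omega, ← h, Nat.add_sub_cancel]

theorem card_filter_stratum {n k k' : ℕ} (hk : k ≤ k') (hk' : k' ≤ n)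
    (P : (Fin n → F) → Prop) [DecidablePred P]
    (hP : ∀ x y, (∀ j : Fin n, (j : ℕ) < k → x j = y j) → (P x ↔ P y)) {L : ℕ}
    (hL : #{x : Fin n → F | (∀ j, x j ≠ 0) ∧ P x} = (Fintype.card F - 1) ^ (n - k) * L) :
    #{x : Fin n → F | ((∀ j : Fin n, (j : ℕ) < k → x j ≠ 0) ∧ P x) ∧
        ∃ j : Fin n, k ≤ (j : ℕ) ∧ (j : ℕ) < k' ∧ x j = 0} =
      Fintype.card F ^ (n - k') *
        (Fintype.card F ^ (k' - k) - (Fintype.card F - 1) ^ (k' - k)) * L := by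
  have hkn := hk.trans hk'
  have hq : 1 < Fintype.card F := Fintype.one_lt_card
  set P' : (Fin n → F) → Prop := fun x => (∀ j : Fin n, (j : ℕ) < k → x j ≠ 0) ∧ P x
  have hP' (x y : Fin n → F) (h : ∀ j : Fin n, (j : ℕ) < k → x j = y j) : P' x ↔ P' y :=
    and_congr (forall_congr' fun j => forall_congr' fun hj => by rw [h j hj]) (hP x y h)
  have h1 := card_filter_and_mul_card (fun j : Fin n => (j : ℕ) < k) P'
    (fun x => ∃ j : Fin n, k ≤ (j : ℕ) ∧ (j : ℕ) < k' ∧ x j = 0) hP' fun x y h =>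
      exists_congr fun j => and_congr_right fun hj => by rw [h j hj.not_gt]
  have h2 := card_filter_and_mul_card (fun j : Fin n => (j : ℕ) < k) P'
    (fun x => ∀ j : Fin n, k ≤ (j : ℕ) → (j : ℕ) < n → x j ≠ 0) hP' fun x y h =>
      forall_congr' fun j => forall_congr' fun hj => by rw [h j hj.not_gt]
  have h3 : #{x : Fin n → F | P' x ∧ ∀ j : Fin n, k ≤ (j : ℕ) → (j : ℕ) < n → x j ≠ 0} =
      (Fintype.card F - 1) ^ (n - k) * L := by
    rw [← hL]
    congr 1
    ext x
    simp only [mem_filter_univ, P']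
    constructor
    · rintro ⟨⟨h, h'⟩, h''⟩
      exact ⟨fun j => (lt_or_ge (j : ℕ) k).elim (h j) fun hj => h'' j hj j.2, h'⟩
    · rintro ⟨h, h'⟩
      exact ⟨⟨fun j _ => h j, h'⟩, fun j _ _ => h j⟩
  rw [h3, card_filter_ne_zero_on_Ico hkn le_rfl, Fintype.card_fun, Fintype.card_fin] at h2
  rw [card_filter_exists_eq_zero_on_Ico hk hk', Fintype.card_fun, Fintype.card_fin] at h1
  set q := Fintype.card F
  have hpos : 0 < q ^ n * (q - 1) ^ (n - k) * q ^ k := by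
    have : 0 < q - 1 := by omega
    positivity
  refine Nat.eq_of_mul_eq_mul_left hpos ?_
  set D := q ^ (k' - k) - (q - 1) ^ (k' - k)
  rw [Nat.sub_self, pow_zero, mul_one] at h2
  set C := #{x : Fin n → F | P' x ∧ ∃ j : Fin n, k ≤ (j : ℕ) ∧ (j : ℕ) < k' ∧ x j = 0}
  calc q ^ n * (q - 1) ^ (n - k) * q ^ k * C = (C * q ^ n) * ((q - 1) ^ (n - k) * q ^ k) := by ring
    _ = q ^ k * D * q ^ (n - k') * (#{x | P' x} * (q ^ k * (q - 1) ^ (n - k))) := by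
      rw [h1]; ring
    _ = q ^ n * (q - 1) ^ (n - k) * q ^ k * (q ^ (n - k') * D * L) := by rw [← h2]; ring

theorem IsSmithDatum.card_filter_monomials {ρ n s : ℕ} {e : Fin ρ → Fin n → ℕ}
    {U : Matrix (Fin ρ) (Fin ρ) ℤ} {V : Matrix (Fin n) (Fin n) ℤ} {d : ℕ → ℕ}
    (hM : IsSmithDatum (Matrix.of fun i j => (e i j : ℤ)) U V s d)
    (α : Fˣ) (hα : ∀ β : Fˣ, β ∈ Subgroup.zpowers α)
    (ind : Fˣ → ℕ) (hind : ∀ β, α ^ ind β = β)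
    (R : (Fin ρ → F) → Prop) [DecidablePred R] :
    #{x : Fin n → F | (∀ j, x j ≠ 0) ∧ R fun i => ∏ j, x j ^ e i j} =
      Nat.card {u : Fin ρ → Fˣ // R (fun i => (u i : F)) ∧
        IndexCond (Fintype.card F - 1) U s d fun i => (ind (u i) : ℤ)} *
      ((Fintype.card F - 1) ^ (n - s) *
        ∏ j ∈ range s, (Fintype.card F - 1).gcd (d j)) := by
  classical
  set m := Fintype.card F - 1 with hm
  have hq : 1 < Fintype.card F := Fintype.one_lt_card
  have : NeZero m := ⟨by omega⟩
  have hord : orderOf α = m := by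
    rw [orderOf_eq_card_of_forall_mem_zpowers hα, Nat.card_eq_fintype_card, Fintype.card_units]
  have hpow (a b : ℕ) : α ^ a = α ^ b ↔ (a : ZMod m) = b := by
    rw [pow_eq_pow_iff_modEq, hord, ZMod.natCast_eq_natCast_iff]
  have hlog (β γ : Fˣ) : β = γ ↔ (ind β : ZMod m) = ind γ := by
    rw [← hpow, hind, hind]
  have hmon (y : Fin n → Fˣ) (i : Fin ρ) : ∏ j, y j ^ e i j = α ^ ∑ j, e i j * ind (y j) := by
    rw [← Finset.prod_pow_eq_pow_sum]
    refine Finset.prod_congr rfl fun j _ => ?_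
    rw [mul_comm, pow_mul, hind]
  have hfib (u : Fin ρ → Fˣ) : #{y : Fin n → Fˣ | (fun i => ∏ j, y j ^ e i j) = u} =
      if IndexCond m U s d (fun i => (ind (u i) : ℤ)) then
        m ^ (n - s) * ∏ j ∈ range s, m.gcd (d j) else 0 := by
    rw [← hM.card_filter_mulVec_eq]
    refine Finset.card_bijective (fun y j => (ind (y j) : ZMod m)) ⟨?_, ?_⟩ ?_
    · intro y z h
      ext1 j
      exact (hlog _ _).2 (congrFun h j)
    · intro x
      refine ⟨fun j => α ^ (x j).val, funext fun j => ?_⟩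
      have : (ind (α ^ (x j).val) : ZMod m) = ((x j).val : ℕ) := by rw [← hpow, hind]
      simpa using this
    · intro y
      simp only [mem_filter_univ, funext_iff]
      refine forall_congr' fun i => ?_
      rw [hmon, ← hind (u i), hpow, hind]
      simp [Matrix.mulVec, dotProduct]
  have hunits : #{x : Fin n → F | (∀ j, x j ≠ 0) ∧ R fun i => ∏ j, x j ^ e i j} =
      #{y : Fin n → Fˣ | R fun i => ((∏ j, y j ^ e i j : Fˣ) : F)} := by
    symm
    refine Finset.card_bij (fun y _ j => (y j : F)) ?_ ?_ ?_
    · intro y hy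
      simpa using hy
    · intro y _ z _ h
      ext j
      exact congrFun h j
    · intro x hx
      rw [mem_filter_univ] at hx
      exact ⟨fun j => Units.mk0 (x j) (hx.1 j), by simpa using hx.2, rfl⟩
  rw [hunits, Nat.card_eq_fintype_card, Fintype.card_subtype,
    Finset.card_eq_sum_card_fiberwise (f := fun y i => ∏ j, y j ^ e i j)
      (t := ({u : Fin ρ → Fˣ | R fun i => (u i : F)} : Finset _))
      (fun y hy => by simpa using hy)]
  have hsum (u : Fin ρ → Fˣ) (hu : u ∈ ({u : Fin ρ → Fˣ | R fun i => (u i : F)} : Finset _)) :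
      #{y ∈ ({y : Fin n → Fˣ | R fun i => ((∏ j, y j ^ e i j : Fˣ) : F)} : Finset _) |
        (fun i => ∏ j, y j ^ e i j) = u} =
      if IndexCond m U s d (fun i => (ind (u i) : ℤ)) then
        m ^ (n - s) * ∏ j ∈ range s, m.gcd (d j) else 0 := by
    rw [← hfib, Finset.filter_filter]
    congr 1
    ext y
    simp only [mem_filter_univ, and_iff_right_iff_imp] at hu ⊢
    rintro rfl
    exact hu
  rw [Finset.sum_congr rfl hsum, ← Finset.sum_filter, Finset.sum_const, Finset.filter_filter,
    smul_eq_mul]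

theorem IsSmithDatum.card_filter_stratum {ρ n s k k' : ℕ} {e : Fin ρ → Fin n → ℕ}
    {U : Matrix (Fin ρ) (Fin ρ) ℤ} {V : Matrix (Fin n) (Fin n) ℤ} {d : ℕ → ℕ}
    (hM : IsSmithDatum (Matrix.of fun i j => (e i j : ℤ)) U V s d)
    (α : Fˣ) (hα : ∀ β : Fˣ, β ∈ Subgroup.zpowers α)
    (ind : Fˣ → ℕ) (hind : ∀ β, α ^ ind β = β)
    (R : (Fin ρ → F) → Prop) [DecidablePred R]
    (hk : k ≤ k') (hk' : k' ≤ n) (he : ∀ i (j : Fin n), k ≤ (j : ℕ) → e i j = 0) :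
    #{x : Fin n → F | ((∀ j : Fin n, (j : ℕ) < k → x j ≠ 0) ∧ R fun i => ∏ j, x j ^ e i j) ∧
        ∃ j : Fin n, k ≤ (j : ℕ) ∧ (j : ℕ) < k' ∧ x j = 0} =
      Fintype.card F ^ (n - k') *
        (Fintype.card F ^ (k' - k) - (Fintype.card F - 1) ^ (k' - k)) *
      (Nat.card {u : Fin ρ → Fˣ // R (fun i => (u i : F)) ∧
        IndexCond (Fintype.card F - 1) U s d fun i => (ind (u i) : ℤ)} *
      (Fintype.card F - 1) ^ (k - s) *
        ∏ j ∈ range s, (Fintype.card F - 1).gcd (d j)) := by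
  have hkn := hk.trans hk'
  have hsk : s ≤ k := hM.le_of_cols_eq_zero hkn fun i j hj => by simp [he i j hj]
  refine _root_.card_filter_stratum hk hk' _ ?_ ?_
  · intro x y h
    have : (fun i => ∏ j, x j ^ e i j) = fun i => ∏ j, y j ^ e i j := by
      refine funext fun i => Finset.prod_congr rfl fun j _ => ?_
      rcases lt_or_ge (j : ℕ) k with hj | hj
      · rw [h j hj]
      · rw [he i j hj, pow_zero, pow_zero]
    rw [this]
  · rw [hM.card_filter_monomials α hα ind hind R, show n - s = n - k + (k - s) by omega, pow_add]
    ring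

theorem card_filter_forall_ne_zero_split {n k k' : ℕ} (hk : k ≤ k')
    (S : (Fin n → F) → Prop) [DecidablePred S] :
    #{x : Fin n → F | (∀ j : Fin n, (j : ℕ) < k → x j ≠ 0) ∧ S x} =
      #{x : Fin n → F | ((∀ j : Fin n, (j : ℕ) < k → x j ≠ 0) ∧ S x) ∧
        ∃ j : Fin n, k ≤ (j : ℕ) ∧ (j : ℕ) < k' ∧ x j = 0} +
      #{x : Fin n → F | (∀ j : Fin n, (j : ℕ) < k' → x j ≠ 0) ∧ S x} := by
  rw [← Finset.card_filter_add_card_filter_not (s := ({x : Fin n → F |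
      (∀ j : Fin n, (j : ℕ) < k → x j ≠ 0) ∧ S x} : Finset _))
    (fun x => ∃ j : Fin n, k ≤ (j : ℕ) ∧ (j : ℕ) < k' ∧ x j = 0),
    Finset.filter_filter, Finset.filter_filter]
  congr 2
  ext x
  simp only [mem_filter_univ]
  push Not
  constructor
  · rintro ⟨⟨h, hS⟩, h'⟩
    exact ⟨fun j hj => (lt_or_ge (j : ℕ) k).elim (h j) fun hkj => h' j hkj hj, hS⟩
  · rintro ⟨h, hS⟩
    exact ⟨⟨fun j hj => h j (hj.trans_le hk), hS⟩, fun j _ hj => h j hj⟩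

end Strata

theorem sum_range_monomial_eq_of_coord_eq_zero {F : Type*} [Field F] {n p r : ℕ} (hpr : p ≤ r) (a : ℕ → Fˣ)
    (E : ℕ → ℕ → ℕ) {x : Fin n → F} {j : Fin n} (hx : x j = 0)
    (hE : ∀ i, p ≤ i → i < r → 0 < E i j) :
    ∑ i ∈ range r, (a i : F) * ∏ j : Fin n, x j ^ E i (j : ℕ) =
      ∑ i ∈ range p, (a i : F) * ∏ j : Fin n, x j ^ E i (j : ℕ) := by
  refine (Finset.sum_subset (Finset.range_mono hpr) fun i hi hi' => ?_).symm
  rw [mem_range] at hi hi'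
  rw [Finset.prod_eq_zero (mem_univ j), mul_zero]
  rw [hx, zero_pow (hE i (not_lt.1 hi') hi).ne']

theorem sum_fin_stack_left {F : Type*} [NonUnitalNonAssocSemiring F]
    (a f g : ℕ → F) (p₁ p₂ : ℕ) :
    (∑ i : Fin (p₁ + p₂), if (i : ℕ) < p₁ then
        a i * (if (i : ℕ) < p₁ then f i else g (i - p₁)) else 0) =
      ∑ i ∈ range p₁, a i * f i := by
  rw [Fin.sum_univ_add]
  simp [Finset.sum_range]

theorem sum_fin_stack_right {F : Type*} [NonUnitalNonAssocSemiring F]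
    (a f g : ℕ → F) (p₁ p₂ : ℕ) :
    (∑ i : Fin (p₁ + p₂), if p₁ ≤ (i : ℕ) then
        a (i - p₁) * (if (i : ℕ) < p₁ then f i else g (i - p₁)) else 0) =
      ∑ i ∈ range p₂, a i * g i := by
  rw [Fin.sum_univ_add, Finset.sum_eq_zero fun i _ => if_neg i.2.not_ge, zero_add]
  simp [Finset.sum_range]

theorem stackM_eq_of (E₁ E₂ : ℕ → ℕ → ℕ) (p₁ p₂ n : ℕ) :
    stackM E₁ E₂ p₁ p₂ n = Matrix.of fun (i : Fin (p₁ + p₂)) (j : Fin n) =>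
      ((if (i : ℕ) < p₁ then E₁ i j else E₂ (i - p₁) j : ℕ) : ℤ) := by
  ext i j
  simp [stackM]

theorem rational_points_case_n2_lt_n3
    (F : Type) [Field F] [Fintype F] [DecidableEq F]
    (q : ℕ) (hq : q = Fintype.card F)
    (hqpow : ∃ p k : ℕ, Nat.Prime p ∧ Odd p ∧ 0 < k ∧ q = p ^ k)
    (α : Fˣ) (hα : ∀ β : Fˣ, β ∈ Subgroup.zpowers α)
    (ind : Fˣ → ℕ)
    (hind : ∀ β : Fˣ, 1 ≤ ind β ∧ ind β ≤ q - 1 ∧ α ^ ind β = β)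
    (r₁ r₂ r₃ r₄ n₁ n₂ n₃ n₄ : ℕ)
    (hr₁ : 0 < r₁) (hr₁₂ : r₁ < r₂) (hr₃ : 0 < r₃) (hr₃₄ : r₃ < r₄)
    (hn₁ : 0 < n₁) (hn₁₂ : n₁ < n₂) (hn₃ : 0 < n₃) (hn₃₄ : n₃ < n₄)
    (hn₁₃ : n₁ ≤ n₃)
    (b₁ b₂ : F) (a₁ a₂ : ℕ → Fˣ)
    (E₁ E₂ : ℕ → ℕ → ℕ)
    (hE₁p : ∀ i, i < r₁ → ∀ j, j < n₁ → 0 < E₁ i j)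
    (hE₁z : ∀ i, i < r₁ → ∀ j, n₁ ≤ j → E₁ i j = 0)
    (hE₁p' : ∀ i, r₁ ≤ i → i < r₂ → ∀ j, j < n₂ → 0 < E₁ i j)
    (hE₁z' : ∀ i, r₁ ≤ i → i < r₂ → ∀ j, n₂ ≤ j → E₁ i j = 0)
    (hE₂p : ∀ i, i < r₃ → ∀ j, j < n₃ → 0 < E₂ i j)
    (hE₂z : ∀ i, i < r₃ → ∀ j, n₃ ≤ j → E₂ i j = 0)
    (hE₂p' : ∀ i, r₃ ≤ i → i < r₄ → ∀ j, j < n₄ → 0 < E₂ i j)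
    (hE₂z' : ∀ i, r₃ ≤ i → i < r₄ → ∀ j, n₄ ≤ j → E₂ i j = 0)
    (h₂₃ : n₂ < n₃)
    (U₁ : Matrix (Fin (r₁)) (Fin (r₁)) ℤ) (V₁ : Matrix (Fin (n₄)) (Fin (n₄)) ℤ)
    (s₁ : ℕ) (d₁ : ℕ → ℕ)
    (hSD₁ : IsSmithDatum ((Matrix.of fun (i : Fin (r₁)) (j : Fin (n₄)) => (E₁ (i : ℕ) (j : ℕ) : ℤ))) U₁ V₁ s₁ d₁)
    (U₂ : Matrix (Fin (r₂)) (Fin (r₂)) ℤ) (V₂ : Matrix (Fin (n₄)) (Fin (n₄)) ℤ)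
    (s₂ : ℕ) (d₂ : ℕ → ℕ)
    (hSD₂ : IsSmithDatum ((Matrix.of fun (i : Fin (r₂)) (j : Fin (n₄)) => (E₁ (i : ℕ) (j : ℕ) : ℤ))) U₂ V₂ s₂ d₂)
    (U₃ : Matrix (Fin (r₂ + r₃)) (Fin (r₂ + r₃)) ℤ) (V₃ : Matrix (Fin (n₄)) (Fin (n₄)) ℤ)
    (s₃ : ℕ) (d₃ : ℕ → ℕ)
    (hSD₃ : IsSmithDatum (stackM E₁ E₂ r₂ r₃ n₄) U₃ V₃ s₃ d₃)
    (U₄ : Matrix (Fin (r₂ + r₄)) (Fin (r₂ + r₄)) ℤ) (V₄ : Matrix (Fin (n₄)) (Fin (n₄)) ℤ)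
    (s₄ : ℕ) (d₄ : ℕ → ℕ)
    (hSD₄ : IsSmithDatum (stackM E₁ E₂ r₂ r₄ n₄) U₄ V₄ s₄ d₄)
    (H₁ : ℕ)
    (hH₁ : H₁ = Nat.card {u : Fin (r₁) → Fˣ //
      (∑ i : Fin (r₁), (a₁ (i : ℕ) : F) * ((u i : F))) = b₁ ∧
      IndexCond (q - 1) U₁ s₁ d₁ fun i => (ind (u i) : ℤ)})
    (H₂ : ℕ)
    (hH₂ : H₂ = Nat.card {u : Fin (r₂) → Fˣ //
      (∑ i : Fin (r₂), (a₁ (i : ℕ) : F) * ((u i : F))) = b₁ ∧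
      IndexCond (q - 1) U₂ s₂ d₂ fun i => (ind (u i) : ℤ)})
    (H₃ : ℕ)
    (hH₃ : H₃ = Nat.card {w : Fin (r₂ + r₃) → Fˣ //
      (∑ i : Fin (r₂ + r₃), if (i : ℕ) < r₂ then (a₁ (i : ℕ) : F) * ((w i : F)) else 0) = b₁ ∧
      (∑ i : Fin (r₂ + r₃), if r₂ ≤ (i : ℕ) then (a₂ ((i : ℕ) - r₂) : F) * ((w i : F)) else 0) = b₂ ∧
      IndexCond (q - 1) U₃ s₃ d₃ fun i => (ind (w i) : ℤ)})
    (H₄ : ℕ)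
    (hH₄ : H₄ = Nat.card {w : Fin (r₂ + r₄) → Fˣ //
      (∑ i : Fin (r₂ + r₄), if (i : ℕ) < r₂ then (a₁ (i : ℕ) : F) * ((w i : F)) else 0) = b₁ ∧
      (∑ i : Fin (r₂ + r₄), if r₂ ≤ (i : ℕ) then (a₂ ((i : ℕ) - r₂) : F) * ((w i : F)) else 0) = b₂ ∧
      IndexCond (q - 1) U₄ s₄ d₄ fun i => (ind (w i) : ℤ)})
    (L₁ : ℕ)
    (hL₁ : L₁ = H₁ * (q - 1) ^ (n₁ - s₁) * ∏ j ∈ Finset.range s₁, Nat.gcd (q - 1) (d₁ j))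
    (L₂ : ℕ)
    (hL₂ : L₂ = H₂ * (q - 1) ^ (n₂ - s₂) * ∏ j ∈ Finset.range s₂, Nat.gcd (q - 1) (d₂ j))
    (L₃ : ℕ)
    (hL₃ : L₃ = H₃ * (q - 1) ^ (n₃ - s₃) * ∏ j ∈ Finset.range s₃, Nat.gcd (q - 1) (d₃ j))
    (L₄ : ℕ)
    (hL₄ : L₄ = H₄ * (q - 1) ^ (n₄ - s₄) * ∏ j ∈ Finset.range s₄, Nat.gcd (q - 1) (d₄ j))
    :
    Nat.card {x : Fin (n₄) → F //
      (∑ i ∈ Finset.range r₂, (a₁ i : F) * ∏ j : Fin (n₄), x j ^ E₁ i (j : ℕ)) = b₁ ∧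
      (∑ i ∈ Finset.range r₄, (a₂ i : F) * ∏ j : Fin (n₄), x j ^ E₂ i (j : ℕ)) = b₂} =
      (if b₁ = 0 ∧ b₂ = 0 then q ^ (n₄ - n₁) * (q ^ n₁ - (q - 1) ^ n₁) else 0) +
      (if b₂ = 0 then q ^ (n₄ - n₂) * (q ^ (n₂ - n₁) - (q - 1) ^ (n₂ - n₁)) * L₁ else 0) +
      (q ^ (n₄ - n₃) - (q - 1) ^ (n₄ - n₃)) * L₃ +
      L₄ +
      (if b₂ = 0 then q ^ (n₄ - n₃) * (q ^ (n₃ - n₂) - (q - 1) ^ (n₃ - n₂)) * L₂ else 0) := by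
  subst hq
  have hind' (β : Fˣ) : α ^ ind β = β := (hind β).2.2
  set f₁ : ℕ → (Fin n₄ → F) → F := fun r x =>
    ∑ i ∈ range r, (a₁ i : F) * ∏ j : Fin n₄, x j ^ E₁ i (j : ℕ)
  set f₂ : ℕ → (Fin n₄ → F) → F := fun r x =>
    ∑ i ∈ range r, (a₂ i : F) * ∏ j : Fin n₄, x j ^ E₂ i (j : ℕ)
  have hstack₁ (r : ℕ) (x : Fin n₄ → F) :
      (∑ i : Fin (r₂ + r), if (i : ℕ) < r₂ then (a₁ (i : ℕ) : F) *
        ∏ j, x j ^ (if (i : ℕ) < r₂ then E₁ i j else E₂ (i - r₂) j) else 0) = f₁ r₂ x := by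
    refine Eq.trans ?_ (sum_fin_stack_left (fun i => (a₁ i : F)) (fun i => ∏ j : Fin n₄, x j ^ E₁ i (j : ℕ))
      (fun i => ∏ j : Fin n₄, x j ^ E₂ i (j : ℕ)) r₂ r)
    exact Finset.sum_congr rfl fun i _ => by split_ifs <;> rfl
  have hstack₂ (r : ℕ) (x : Fin n₄ → F) :
      (∑ i : Fin (r₂ + r), if r₂ ≤ (i : ℕ) then (a₂ ((i : ℕ) - r₂) : F) *
        ∏ j, x j ^ (if (i : ℕ) < r₂ then E₁ i j else E₂ (i - r₂) j) else 0) = f₂ r x := by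
    refine Eq.trans ?_ (sum_fin_stack_right (fun i => (a₂ i : F)) (fun i => ∏ j : Fin n₄, x j ^ E₁ i (j : ℕ))
      (fun i => ∏ j : Fin n₄, x j ^ E₂ i (j : ℕ)) r₂ r)
    exact Finset.sum_congr rfl fun i _ => by split_ifs <;> rfl
  have hfin₁ (r : ℕ) (x : Fin n₄ → F) :
      ∑ i : Fin r, (a₁ (i : ℕ) : F) * ∏ j, x j ^ E₁ i j = f₁ r x :=
    (Finset.sum_range fun i => (a₁ i : F) * ∏ j : Fin n₄, x j ^ E₁ i (j : ℕ)).symm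
  have hE₁₂ (i : ℕ) (hi : i < r₂) (j : ℕ) (hj : n₂ ≤ j) : E₁ i j = 0 :=
    (lt_or_ge i r₁).elim (fun h => hE₁z i h j (hn₁₂.le.trans hj)) fun h => hE₁z' i h hi j hj
  have hf₁_zero (x : Fin n₄ → F) (j : Fin n₄) (hj : (j : ℕ) < n₁) (hx : x j = 0) :
      f₁ r₂ x = 0 :=
    (sum_range_monomial_eq_of_coord_eq_zero (Nat.zero_le r₂) a₁ E₁ hx fun i _ hi =>
      (lt_or_ge i r₁).elim (fun h => hE₁p i h j hj)
        fun h => hE₁p' i h hi j (hj.trans hn₁₂)).trans rfl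
  have hf₁_trunc (x : Fin n₄ → F) (j : Fin n₄) (hj : (j : ℕ) < n₂) (hx : x j = 0) :
      f₁ r₂ x = f₁ r₁ x :=
    sum_range_monomial_eq_of_coord_eq_zero hr₁₂.le a₁ E₁ hx fun i h hi => hE₁p' i h hi j hj
  have hf₂_zero (x : Fin n₄ → F) (j : Fin n₄) (hj : (j : ℕ) < n₃) (hx : x j = 0) :
      f₂ r₄ x = 0 :=
    (sum_range_monomial_eq_of_coord_eq_zero (Nat.zero_le r₄) a₂ E₂ hx fun i _ hi =>
      (lt_or_ge i r₃).elim (fun h => hE₂p i h j hj)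
        fun h => hE₂p' i h hi j j.2).trans rfl
  have hf₂_trunc (x : Fin n₄ → F) (j : Fin n₄) (hx : x j = 0) : f₂ r₄ x = f₂ r₃ x :=
    sum_range_monomial_eq_of_coord_eq_zero hr₃₄.le a₂ E₂ hx fun i h hi => hE₂p' i h hi j j.2
  have htotal : Nat.card {x : Fin n₄ → F // f₁ r₂ x = b₁ ∧ f₂ r₄ x = b₂} =
      #{x : Fin n₄ → F | (∀ j : Fin n₄, (j : ℕ) < 0 → x j ≠ 0) ∧ f₁ r₂ x = b₁ ∧ f₂ r₄ x = b₂} := by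
    simp [Nat.card_eq_fintype_card, Fintype.card_subtype]
  have hcount₀ : #{x : Fin n₄ → F | ((∀ j : Fin n₄, (j : ℕ) < 0 → x j ≠ 0) ∧
      f₁ r₂ x = b₁ ∧ f₂ r₄ x = b₂) ∧ ∃ j : Fin n₄, 0 ≤ (j : ℕ) ∧ (j : ℕ) < n₁ ∧ x j = 0} =
      if b₁ = 0 ∧ b₂ = 0 then Fintype.card F ^ (n₄ - n₁) *
        (Fintype.card F ^ n₁ - (Fintype.card F - 1) ^ n₁) else 0 := by
    split_ifs with hb
    · have h := card_filter_exists_eq_zero_on_Ico (F := F) (Nat.zero_le n₁)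
        ((hn₁₂.trans h₂₃).trans hn₃₄).le
      rw [pow_zero, one_mul, Nat.sub_zero, mul_comm] at h
      rw [← h]
      congr 1
      ext x
      simp only [mem_filter_univ, and_iff_right_iff_imp]
      rintro ⟨j, -, hj, hx⟩
      exact ⟨fun _ h => absurd h (Nat.not_lt_zero _), by rw [hf₁_zero x j hj hx, hb.1],
        by rw [hf₂_zero x j (hj.trans (hn₁₂.trans h₂₃)) hx, hb.2]⟩
    · rw [Finset.card_eq_zero, Finset.filter_eq_empty_iff]
      rintro x - ⟨⟨-, h₁, h₂⟩, j, -, hj, hx⟩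
      exact hb ⟨by rw [← h₁, hf₁_zero x j hj hx],
        by rw [← h₂, hf₂_zero x j (hj.trans (hn₁₂.trans h₂₃)) hx]⟩
  have hcount₁ : #{x : Fin n₄ → F | ((∀ j : Fin n₄, (j : ℕ) < n₁ → x j ≠ 0) ∧
      f₁ r₂ x = b₁ ∧ f₂ r₄ x = b₂) ∧ ∃ j : Fin n₄, n₁ ≤ (j : ℕ) ∧ (j : ℕ) < n₂ ∧ x j = 0} =
      if b₂ = 0 then Fintype.card F ^ (n₄ - n₂) *
        (Fintype.card F ^ (n₂ - n₁) - (Fintype.card F - 1) ^ (n₂ - n₁)) * L₁ else 0 := by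
    split_ifs with hb
    · rw [hL₁, hH₁, ← hSD₁.card_filter_stratum α hα ind hind'
        (fun u => ∑ i : Fin r₁, (a₁ (i : ℕ) : F) * u i = b₁) hn₁₂.le (h₂₃.trans hn₃₄).le
        fun i j hj => hE₁z i i.2 j hj]
      congr 1
      ext x
      simp only [mem_filter_univ, hfin₁]
      refine and_congr_left fun ⟨j, _, hj, hx⟩ => and_congr_right fun _ => ?_
      simp [hf₁_trunc x j hj hx, hf₂_zero x j (hj.trans h₂₃) hx, hb]
    · rw [Finset.card_eq_zero, Finset.filter_eq_empty_iff]
      rintro x - ⟨⟨-, -, h₂⟩, j, -, hj, hx⟩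
      exact hb (by rw [← h₂, hf₂_zero x j (hj.trans h₂₃) hx])
  have hcount₂ : #{x : Fin n₄ → F | ((∀ j : Fin n₄, (j : ℕ) < n₂ → x j ≠ 0) ∧
      f₁ r₂ x = b₁ ∧ f₂ r₄ x = b₂) ∧ ∃ j : Fin n₄, n₂ ≤ (j : ℕ) ∧ (j : ℕ) < n₃ ∧ x j = 0} =
      if b₂ = 0 then Fintype.card F ^ (n₄ - n₃) *
        (Fintype.card F ^ (n₃ - n₂) - (Fintype.card F - 1) ^ (n₃ - n₂)) * L₂ else 0 := by
    split_ifs with hb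
    · rw [hL₂, hH₂, ← hSD₂.card_filter_stratum α hα ind hind'
        (fun u => ∑ i : Fin r₂, (a₁ (i : ℕ) : F) * u i = b₁) h₂₃.le hn₃₄.le
        fun i j hj => hE₁₂ i i.2 j hj]
      congr 1
      ext x
      simp only [mem_filter_univ, hfin₁]
      refine and_congr_left fun ⟨j, _, hj, hx⟩ => and_congr_right fun _ => ?_
      simp [hf₂_zero x j hj hx, hb]
    · rw [Finset.card_eq_zero, Finset.filter_eq_empty_iff]
      rintro x - ⟨⟨-, -, h₂⟩, j, -, hj, hx⟩
      exact hb (by rw [← h₂, hf₂_zero x j hj hx])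
  rw [stackM_eq_of] at hSD₃ hSD₄
  have hcount₃ : #{x : Fin n₄ → F | ((∀ j : Fin n₄, (j : ℕ) < n₃ → x j ≠ 0) ∧
      f₁ r₂ x = b₁ ∧ f₂ r₄ x = b₂) ∧ ∃ j : Fin n₄, n₃ ≤ (j : ℕ) ∧ (j : ℕ) < n₄ ∧ x j = 0} =
      (Fintype.card F ^ (n₄ - n₃) - (Fintype.card F - 1) ^ (n₄ - n₃)) * L₃ := by
    have h := hSD₃.card_filter_stratum α hα ind hind'
      (fun w =>
        (∑ i : Fin (r₂ + r₃), if (i : ℕ) < r₂ then (a₁ (i : ℕ) : F) * w i else 0) = b₁ ∧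
        (∑ i : Fin (r₂ + r₃), if r₂ ≤ (i : ℕ) then (a₂ ((i : ℕ) - r₂) : F) * w i else 0) = b₂)
      hn₃₄.le le_rfl fun i j hj => by
        split_ifs with hi
        · exact hE₁₂ i hi j (h₂₃.le.trans hj)
        · exact hE₂z _ (by omega) j hj
    simp only [and_assoc, hstack₁, hstack₂] at h
    rw [Nat.sub_self, pow_zero, one_mul, ← hH₃, ← hL₃] at h
    rw [← h]
    congr 1
    ext x
    simp only [mem_filter_univ, and_assoc]
    refine and_congr_right fun _ => and_congr_right fun _ => and_congr_left fun ⟨j, _, _, hx⟩ => ?_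
    rw [hf₂_trunc x j hx]
  have hcount₄ : #{x : Fin n₄ → F | (∀ j : Fin n₄, (j : ℕ) < n₄ → x j ≠ 0) ∧
      f₁ r₂ x = b₁ ∧ f₂ r₄ x = b₂} = L₄ := by
    have h := hSD₄.card_filter_monomials α hα ind hind'
      (fun w =>
        (∑ i : Fin (r₂ + r₄), if (i : ℕ) < r₂ then (a₁ (i : ℕ) : F) * w i else 0) = b₁ ∧
        (∑ i : Fin (r₂ + r₄), if r₂ ≤ (i : ℕ) then (a₂ ((i : ℕ) - r₂) : F) * w i else 0) = b₂)
    simp only [and_assoc, hstack₁, hstack₂] at h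
    rw [← hH₄, ← mul_assoc, ← hL₄] at h
    simpa only [Fin.is_lt, forall_true_left] using h
  change Nat.card {x : Fin n₄ → F // f₁ r₂ x = b₁ ∧ f₂ r₄ x = b₂} = _
  rw [htotal, card_filter_forall_ne_zero_split (Nat.zero_le n₁),
    card_filter_forall_ne_zero_split hn₁₂.le, card_filter_forall_ne_zero_split h₂₃.le,
    card_filter_forall_ne_zero_split hn₃₄.le, hcount₀, hcount₁, hcount₂, hcount₃, hcount₄]
  ring
end
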